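/- Let G be a countably infinite amenable group and P = [0,1]. There exists a minimal subshift X ⊆ P^G (a closed shift-invariant subset on which every orbit is dense) whose mean topological dimension equals 1 = dim(P). -/

import Mathlib

open Set Filter Topology

/-- `covDimLE X n`: every finite open cover of `X` admits a finite open refinement
of order at most `n` (i.e. each point lies in at most `n+1` members). -/
def covDimLE (X : Type) [TopologicalSpace X] (n : ℕ) : Prop :=
  ∀ (ι : Type) (U : ι → Set X), Finite ι → (∀ i, IsOpen (U i)) → (⋃ i, U i) = Set.univ →
    ∃ (κ : Type) (V : κ → Set X), Finite κ ∧ (∀ j, IsOpen (V j)) ∧ (⋃ j, V j) = Set.univ ∧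
      (∀ j, ∃ i, V j ⊆ U i) ∧ ∀ x : X, Set.ncard {j | x ∈ V j} ≤ n + 1

/-- The topological (covering) dimension of `X`, as an element of `ENNReal`
(`⊤` if no finite bound exists). -/
noncomputable def topDim (X : Type) [TopologicalSpace X] : ENNReal :=
  sInf {d : ENNReal | ∃ n : ℕ, d = n ∧ covDimLE X n}

/-- `ε`-injectivity of `f` with respect to a distance function `ρ` on the source. -/
def IsEpsInj {X P : Type} (ρ : X → X → ℝ) (ε : ℝ) (f : X → P) : Prop :=
  ∀ x y, f x = f y → ρ x y ≤ ε

/-- The `ε`-width dimension `dim_ε(X, ρ)`: the infimum of topological dimensions of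
compact metric spaces `P` admitting an `ε`-injective continuous map `X → P`. -/
noncomputable def dimEps (X : Type) [TopologicalSpace X] (ρ : X → X → ℝ) (ε : ℝ) : ENNReal :=
  sInf {d : ENNReal | ∃ (P : Type) (_ : MetricSpace P) (f : X → P),
    CompactSpace P ∧ Continuous f ∧ IsEpsInj ρ ε f ∧ topDim P = d}


/-- A Følner sequence in a group `G`: nonempty finite sets `F n` such that for every
finite `K ⊆ G`, the proportion of the `K`-boundary `B(F_n,K)` in `F_n` tends to `0`. -/
def IsFolner {G : Type} [Group G] (F : ℕ → Finset G) : Prop :=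
  (∀ n, (F n).Nonempty) ∧ ∀ K : Finset G,
    Tendsto (fun n =>
        (Set.ncard {g : G | (∃ k ∈ K, k * g ∈ F n) ∧ ∃ k ∈ K, k * g ∉ F n} : ℝ)
          / (F n).card)
      atTop (nhds 0)

/-- The upper density of `J ⊆ G`: the supremum over Følner sequences of
`limsup_n |J ∩ F_n| / |F_n|`. -/
noncomputable def upperDensity {G : Type} [Group G] (J : Set G) : ℝ :=
  sSup {r : ℝ | ∃ F : ℕ → Finset G, IsFolner F ∧
    Filter.atTop.limsup (fun n => ((J ∩ (F n : Set G)).ncard : ℝ) / (F n).card) = r}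

/-- The shift map on `P^G`: `(g' · x)_g = x_{g g'}`. -/
def shift {G P : Type} [Group G] (g' : G) (x : G → P) : G → P :=
  fun g => x (g * g')

/-- `ρ` is a metric on `Y` compatible with the given topology. -/
def IsCompatMetric {Y : Type} [TopologicalSpace Y] (ρ : Y → Y → ℝ) : Prop :=
  (∀ x y, ρ x y = 0 ↔ x = y) ∧ (∀ x y, ρ x y = ρ y x) ∧
  (∀ x y z, ρ x z ≤ ρ x y + ρ y z) ∧
  (∀ (x : Y) (S : Set Y), S ∈ nhds x ↔ ∃ ε > 0, {y | ρ x y < ε} ⊆ S)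

/-- The mean topological dimension of a subshift `X ⊆ P^G`, computed from a compatible
metric `ρ` on `P^G` and a Følner sequence `F`:
`mdim = lim_{ε→0} lim_n dim_ε(X, d_{F_n})/|F_n|` with
`d_{F_n}(x,y) = max_{g ∈ F_n} ρ(gx, gy)`. -/
noncomputable def mdimWith {G P : Type} [Group G] [TopologicalSpace P]
    (X : Set (G → P)) (ρ : (G → P) → (G → P) → ℝ)
    (F : ℕ → Finset G) (hF : ∀ n, (F n).Nonempty) : ENNReal :=
  ⨆ (ε : ℝ) (_ : 0 < ε), Filter.atTop.limsup fun n =>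
    dimEps X (fun x y => (F n).sup' (hF n) fun g => ρ (shift g x.1) (shift g y.1)) ε
      / ((F n).card : ENNReal)

/-- `X` is a (compact metric) polyhedron: it is homeomorphic to a finite union of
convex polytopes (convex hulls of finite sets) in some Euclidean space. -/
def IsPolyhedron (X : Type) [TopologicalSpace X] : Prop :=
  ∃ (N : ℕ) (S : Finset (Finset (Fin N → ℝ))),
    Nonempty (X ≃ₜ (⋃ s ∈ S, convexHull ℝ (s : Set (Fin N → ℝ)) : Set (Fin N → ℝ)))



/-! ### Kuhn cubical Sperner lemma -/

/-- Vertex number `j` of the Kuhn simplex with base `v` and order `π`. -/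
def kv {N : ℕ} (v : Fin N → ℕ) (π : Equiv.Perm (Fin N)) (j : ℕ) : Fin N → ℕ :=
  fun i => v i + if j ≤ (π i : ℕ) then 1 else 0

lemma face_parity (N : ℕ) (a : ℕ → ℕ) (ha : ∀ j ∈ Finset.range (N+1), a j ≤ N) :
    ((((Finset.range (N+1)).filter fun j =>
      ((Finset.range (N+1)).erase j).image a = Finset.Icc 1 N).card : ℕ) : ZMod 2)
      = if (Finset.range (N+1)).image a = Finset.range (N+1) then 1 else 0 := by
  classical
  split_ifs with h
  · have hinj : Set.InjOn a (Finset.range (N+1)) := by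
      apply Finset.injOn_of_card_image_eq
      rw [h]
    have h0 : (0:ℕ) ∈ (Finset.range (N+1)).image a := by rw [h]; simp
    obtain ⟨j0, hj0, hj0a⟩ := Finset.mem_image.1 h0
    have : ((Finset.range (N+1)).filter fun j =>
      ((Finset.range (N+1)).erase j).image a = Finset.Icc 1 N) = {j0} := by
      ext j
      simp only [Finset.mem_filter, Finset.mem_singleton]
      constructor
      · rintro ⟨hj, hh⟩
        by_contra hne
        have : a j0 ∈ ((Finset.range (N+1)).erase j).image a :=
          Finset.mem_image_of_mem _ (Finset.mem_erase.2 ⟨fun h => hne h.symm, hj0⟩)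
        rw [hh, hj0a] at this
        simp at this
      · rintro rfl
        refine ⟨hj0, ?_⟩
        ext x
        simp only [Finset.mem_image, Finset.mem_erase, Finset.mem_Icc]
        constructor
        · rintro ⟨y, ⟨hy, hy'⟩, rfl⟩
          refine ⟨?_, ha y hy'⟩
          by_contra hlt
          apply hy
          apply hinj (by exact_mod_cast hy') (by exact_mod_cast hj0)
          omega
        · rintro ⟨h1, h2⟩
          have : x ∈ (Finset.range (N+1)).image a := by rw [h]; simp; omega
          obtain ⟨y, hy, rfl⟩ := Finset.mem_image.1 this
          refine ⟨y, ⟨?_, hy⟩, rfl⟩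
          rintro rfl
          omega
    rw [this]; simp
  · by_cases hex : ∃ j0 ∈ Finset.range (N+1),
      ((Finset.range (N+1)).erase j0).image a = Finset.Icc 1 N
    · obtain ⟨j0, hj0, hf⟩ := hex
      have hinj : Set.InjOn a ((Finset.range (N+1)).erase j0) := by
        apply Finset.injOn_of_card_image_eq
        rw [hf, Finset.card_erase_of_mem hj0]; simp
      have haj0 : a j0 ∈ Finset.Icc 1 N := by
        have h1 := ha j0 hj0
        by_contra hc
        have h0 : a j0 = 0 := by
          simp only [Finset.mem_Icc] at hc; omega
        apply h
        rw [← Finset.insert_erase hj0, Finset.image_insert, hf, h0, Finset.insert_erase hj0]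
        ext x; simp; omega
      have haj0' := haj0
      rw [← hf] at haj0'
      obtain ⟨j1, hj1, hj1a⟩ := Finset.mem_image.1 haj0'
      have hj1' := Finset.mem_erase.1 hj1
      have : ((Finset.range (N+1)).filter fun j =>
        ((Finset.range (N+1)).erase j).image a = Finset.Icc 1 N) = {j0, j1} := by
        ext j
        simp only [Finset.mem_filter, Finset.mem_insert, Finset.mem_singleton]
        constructor
        · rintro ⟨hj, hh⟩
          by_contra hne
          push Not at hne
          have hjm : j ∈ (Finset.range (N+1)).erase j0 := Finset.mem_erase.2 ⟨hne.1, hj⟩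
          have h3 : a j ∈ Finset.Icc 1 N := by
            rw [← hf]; exact Finset.mem_image_of_mem _ hjm
          rw [← hh] at h3
          obtain ⟨y, hy, hya⟩ := Finset.mem_image.1 h3
          have hy' := Finset.mem_erase.1 hy
          by_cases hyj : y = j0
          · subst hyj
            exact hne.2 (hinj (by exact_mod_cast hjm) (by exact_mod_cast hj1)
              (by rw [← hya, hj1a]))
          · exact hy'.1 (hinj (by exact_mod_cast Finset.mem_erase.2 ⟨hyj, hy'.2⟩)
              (by exact_mod_cast hjm) hya)
        · rintro (rfl | rfl)
          · exact ⟨hj0, hf⟩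
          · refine ⟨hj1'.2, ?_⟩
            rw [← hf]
            ext x
            simp only [Finset.mem_image, Finset.mem_erase]
            constructor
            · rintro ⟨y, ⟨hy, hy'⟩, rfl⟩
              by_cases hyj : y = j0
              · exact ⟨j, ⟨hj1'.1, hj1'.2⟩, by rw [hyj, hj1a]⟩
              · exact ⟨y, ⟨hyj, hy'⟩, rfl⟩
            · rintro ⟨y, ⟨hy, hy'⟩, rfl⟩
              by_cases hyj : y = j
              · exact ⟨j0, ⟨fun h => hj1'.1 h.symm, hj0⟩, by rw [hyj, hj1a]⟩
              · exact ⟨y, ⟨hyj, hy'⟩, rfl⟩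
      rw [this, Finset.card_pair (fun h => hj1'.1 h.symm)]
      decide
    · push Not at hex
      rw [Finset.filter_false_of_mem hex]; simp

/-- The fully labelled simplices. -/
def kfull (N M : ℕ) (l : (Fin N → ℕ) → ℕ) : Finset ((Fin N → ℕ) × Equiv.Perm (Fin N)) :=
  ((Fintype.piFinset fun _ => Finset.range M) ×ˢ Finset.univ).filter fun s =>
    (Finset.range (N+1)).image (fun j => l (kv s.1 s.2 j)) = Finset.range (N+1)

/-- Simplices with a distinguished facet. -/
def kface (N M : ℕ) (l : (Fin N → ℕ) → ℕ) :
    Finset (((Fin N → ℕ) × Equiv.Perm (Fin N)) × ℕ) :=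
  (((Fintype.piFinset fun _ => Finset.range M) ×ˢ Finset.univ) ×ˢ Finset.range (N+1)).filter
    fun s => ((Finset.range (N+1)).erase s.2).image (fun j => l (kv s.1.1 s.1.2 j))
      = Finset.Icc 1 N

lemma kv_le {N M : ℕ} {v : Fin N → ℕ} {π : Equiv.Perm (Fin N)} {j : ℕ}
    (hv : v ∈ Fintype.piFinset fun _ => Finset.range M) (i : Fin N) : kv v π j i ≤ M := by
  have := Fintype.mem_piFinset.1 hv i
  simp only [Finset.mem_range] at this
  unfold kv; split_ifs <;> omega

lemma kfull_kface (N M : ℕ) (l : (Fin N → ℕ) → ℕ)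
    (h1 : ∀ v, (∀ i, v i ≤ M) → l v ≤ N) :
    ((kfull N M l).card : ZMod 2) = (kface N M l).card := by
  classical
  unfold kfull kface
  rw [Finset.card_filter, Finset.card_filter, Finset.sum_product (s := _ ×ˢ _)]
  push_cast
  apply Finset.sum_congr rfl
  intro s hs
  rw [Finset.mem_product] at hs
  rw [← face_parity N (fun j => l (kv s.1 s.2 j)) (fun j _ => h1 _ (fun i => kv_le hs.1 i)),
    Finset.card_filter]
  push_cast
  rfl

/-- The facet-adjacency involution. -/
def kinv (n : ℕ) (s : ((Fin (n+1) → ℕ) × Equiv.Perm (Fin (n+1))) × ℕ) :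
    ((Fin (n+1) → ℕ) × Equiv.Perm (Fin (n+1))) × ℕ :=
  if s.2 = 0 then
    ((fun i => if s.1.2 i = 0 then s.1.1 i - 1 else s.1.1 i,
      s.1.2.trans (finRotate (n+1)).symm), n+1)
  else if s.2 = n+1 then
    ((fun i => if s.1.2 i = Fin.last n then s.1.1 i + 1 else s.1.1 i,
      s.1.2.trans (finRotate (n+1))), 0)
  else
    ((s.1.1, s.1.2.trans (Equiv.swap (Fin.ofNat (n+1) (s.2 - 1)) (Fin.ofNat (n+1) s.2))), s.2)

lemma finRotate_val (n : ℕ) (i : Fin (n+1)) :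
    ((finRotate (n+1) i : Fin (n+1)) : ℕ) = if (i:ℕ) = n then 0 else (i:ℕ) + 1 := by
  split_ifs with h
  · have : i = Fin.last n := Fin.ext h
    simp [this]
  · have : i ≠ Fin.last n := fun h' => h (by rw [h']; rfl)
    exact coe_finRotate_of_ne_last this

lemma finRotate_symm_val (n : ℕ) (i : Fin (n+1)) :
    (((finRotate (n+1)).symm i : Fin (n+1)) : ℕ) = if (i:ℕ) = 0 then n else (i:ℕ) - 1 := by
  have h := finRotate_val n ((finRotate (n+1)).symm i)
  rw [Equiv.apply_symm_apply] at h
  have h2 := ((finRotate (n+1)).symm i).isLt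
  have h4 := i.isLt
  split_ifs at h ⊢ <;> omega

lemma swap_val (n j : ℕ) (h0 : j ≠ 0) (h1 : j < n + 1) (i : Fin (n+1)) :
    ((Equiv.swap (Fin.ofNat (n+1) (j - 1)) (Fin.ofNat (n+1) j) i : Fin (n+1)) : ℕ)
      = if (i:ℕ) = j - 1 then j else if (i:ℕ) = j then j - 1 else i := by
  rw [Equiv.swap_apply_def]
  have a : ((Fin.ofNat (n+1) (j-1) : Fin (n+1)) : ℕ) = j - 1 := Nat.mod_eq_of_lt (by omega)
  have b : ((Fin.ofNat (n+1) j : Fin (n+1)) : ℕ) = j := Nat.mod_eq_of_lt (by omega)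
  simp only [Fin.ext_iff, a, b]
  split_ifs <;> simp_all

lemma kinv_kinv (n M : ℕ) (l) (s) (hs : s ∈ kface (n+1) M l)
    (hb : ¬ (s.2 = 0 ∧ ∃ i, s.1.2 i = 0 ∧ s.1.1 i = 0)) : kinv n (kinv n s) = s := by
  obtain ⟨⟨v, π⟩, j⟩ := s
  simp only [kface, Finset.mem_filter, Finset.mem_product, Finset.mem_range] at hs
  have hj : j < n + 1 + 1 := hs.1.2
  simp only at hb
  by_cases h0 : j = 0
  · subst h0
    have hb' : ∀ i, π i = 0 → v i ≠ 0 := fun i h h' => hb ⟨rfl, i, h, h'⟩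
    simp only [kinv, if_true, Nat.add_eq_zero_iff, one_ne_zero, and_false, if_false]
    refine Prod.ext (Prod.ext ?_ ?_) rfl
    · funext i
      have e : ((π.trans (finRotate (n+1)).symm) i = Fin.last n) ↔ π i = 0 := by
        rw [Fin.ext_iff, Equiv.trans_apply, finRotate_symm_val, ← Fin.val_eq_zero_iff]
        have := (π i).isLt
        have h5 : ((Fin.last n : Fin (n+1)) : ℕ) = n := rfl
        rw [h5]
        split_ifs with h <;> omega
      simp only [e]
      by_cases h : π i = 0
      · have := hb' i h
        simp only [h, if_true]; omega
      · simp [h]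
    · ext i; simp
  · by_cases h1 : j = n + 1
    · subst h1
      simp only [kinv, h0, if_true, if_false]
      refine Prod.ext (Prod.ext ?_ ?_) rfl
      · funext i
        have e : ((π.trans (finRotate (n+1))) i = 0) ↔ π i = Fin.last n := by
          rw [← Fin.val_eq_zero_iff, Fin.ext_iff, Equiv.trans_apply, finRotate_val]
          have h5 : ((Fin.last n : Fin (n+1)) : ℕ) = n := rfl
          rw [h5]
          split_ifs with h <;> simp [h]
        simp only [e]
        by_cases h : π i = Fin.last n <;> simp [h]
      · ext i; simp
    · simp only [kinv, h0, h1, if_false]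
      refine Prod.ext (Prod.ext rfl ?_) rfl
      ext i; simp

lemma image_range_shift {α : Type*} [DecidableEq α] (n : ℕ) (a b : ℕ → α)
    (h : ∀ j ≤ n, a j = b (j+1)) :
    ((Finset.range (n+1+1)).erase (n+1)).image a = ((Finset.range (n+1+1)).erase 0).image b := by
  ext x
  simp only [Finset.mem_image, Finset.mem_erase, Finset.mem_range]
  constructor
  · rintro ⟨j, ⟨h1, h2⟩, rfl⟩
    exact ⟨j+1, ⟨by omega, by omega⟩, (h j (by omega)).symm⟩
  · rintro ⟨j, ⟨h1, h2⟩, rfl⟩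
    refine ⟨j-1, ⟨by omega, by omega⟩, ?_⟩
    rw [h _ (by omega)]; congr 1; omega

lemma kinv_mem (n M : ℕ) (hM : 0 < M) (l : (Fin (n+1) → ℕ) → ℕ)
    (h3 : ∀ v : Fin (n+1) → ℕ, (∀ i, v i ≤ M) → ∀ i : Fin _, v i = M → l v ≠ (i:ℕ) + 1)
    (s) (hs : s ∈ kface (n+1) M l)
    (hb : ¬ (s.2 = 0 ∧ ∃ i, s.1.2 i = 0 ∧ s.1.1 i = 0)) :
    kinv n s ∈ kface (n+1) M l ∧
      ¬ ((kinv n s).2 = 0 ∧ ∃ i, (kinv n s).1.2 i = 0 ∧ (kinv n s).1.1 i = 0) := by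
  obtain ⟨⟨v, π⟩, j⟩ := s
  simp only [kface, Finset.mem_filter, Finset.mem_product, Finset.mem_range,
    Fintype.mem_piFinset, Finset.mem_univ, and_true] at hs hb ⊢
  obtain ⟨⟨hv, hj⟩, hf⟩ := hs
  by_cases h0 : j = 0
  · subst h0
    have hb' : ∀ i, π i = 0 → v i ≠ 0 := fun i h h' => hb ⟨rfl, i, h, h'⟩
    simp only [kinv, if_true]
    refine ⟨⟨⟨?_, by omega⟩, ?_⟩, by omega⟩
    · intro i; have := hv i; split_ifs <;> omega
    · rw [← hf]
      apply image_range_shift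
      intro j hj
      congr 1
      funext i
      simp only [kv, Equiv.trans_apply, finRotate_symm_val]
      by_cases h : π i = 0
      · have := hb' i h
        simp only [h, if_true, Fin.coe_ofNat_eq_mod, Nat.zero_mod]
        simp only [hj, if_true]
        simp; omega
      · have : (π i : ℕ) ≠ 0 := fun h' => h (Fin.ext h')
        simp only [h, this, if_false]
        congr 1
        have : j ≤ (π i:ℕ) - 1 ↔ j + 1 ≤ π i := by omega
        simp only [this]
  · by_cases h1 : j = n + 1
    · subst h1
      simp only [kinv, h0, if_true, if_false]
      have key : ∀ i, π i = Fin.last n → v i + 1 < M := by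
        intro i hi
        by_contra hc
        have hvi : v i + 1 = M := by have := hv i; omega
        have hm : (i:ℕ) + 1 ∈ Finset.Icc 1 (n+1) := by simp; omega
        rw [← hf] at hm
        obtain ⟨j, hj, hjl⟩ := Finset.mem_image.1 hm
        simp only [Finset.mem_erase, Finset.mem_range] at hj
        refine h3 (kv v π j) (fun i' => kv_le (by simpa using hv) i') i ?_ hjl
        simp only [kv, hi, Fin.val_last]
        rw [if_pos (by omega)]; exact hvi
      refine ⟨⟨⟨?_, by omega⟩, ?_⟩, ?_⟩
      · intro i; have := hv i; have := key i; split_ifs with h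
        · exact this h
        · omega
      · rw [← hf]
        symm
        apply image_range_shift
        intro j hj
        congr 1
        funext i
        simp only [kv, Equiv.trans_apply, finRotate_val]
        have e : π i = Fin.last n ↔ (π i :ℕ) = n := by rw [Fin.ext_iff]; rfl
        by_cases h : (π i : ℕ) = n
        · simp only [e, h, if_true, hj]; simp
        · simp only [e, h, if_false]
          have : j + 1 ≤ (π i:ℕ) + 1 ↔ j ≤ π i := by omega
          simp only [this]
      · rintro ⟨-, i, hi, hi'⟩
        have e : π i = Fin.last n := by
          rw [Fin.ext_iff, Equiv.trans_apply, finRotate_val] at hi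
          rw [Fin.ext_iff]
          simp only [Fin.val_last, Fin.coe_ofNat_eq_mod, Nat.zero_mod] at hi ⊢
          split_ifs at hi; assumption
        simp [e] at hi'
    · simp only [kinv, h0, h1, if_false]
      refine ⟨⟨⟨hv, hj⟩, ?_⟩, by simp⟩
      rw [← hf]
      apply Finset.image_congr
      intro j' hj'
      simp only [Finset.coe_erase, Set.mem_sdiff, Finset.mem_coe, Finset.mem_range,
        Set.mem_singleton_iff] at hj'
      dsimp only
      congr 1
      funext i
      simp only [kv, Equiv.trans_apply, swap_val n j h0 (by omega)]
      congr 1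
      have : (j' ≤ (if (π i:ℕ) = j - 1 then j else if (π i:ℕ) = j then j - 1 else (π i:ℕ)))
        ↔ j' ≤ (π i:ℕ) := by split_ifs <;> omega
      simp only [this]

lemma kinv_ne (n : ℕ) (s) (hs : s.2 < n + 2) : kinv n s ≠ s := by
  obtain ⟨⟨v, π⟩, j⟩ := s
  simp only at hs
  unfold kinv
  intro h
  split_ifs at h with h0 h1
  · have := congrArg Prod.snd h
    simp only at this h0; omega
  · have := congrArg Prod.snd h
    simp only at this h1; omega
  · simp only at h0 h1
    have h2 := congrArg (fun t => ((t.1.2 (π.symm (Fin.ofNat (n+1) (j-1))) : Fin (n+1)) : ℕ)) h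
    have a : ((Fin.ofNat (n+1) (j-1) : Fin (n+1)) : ℕ) = j - 1 := Nat.mod_eq_of_lt (by omega)
    simp only [Equiv.trans_apply, Equiv.apply_symm_apply] at h2
    rw [swap_val n j h0 (by omega), a] at h2
    simp at h2; omega

lemma kface_boundary (n M : ℕ) (hM : 0 < M) (l : (Fin (n+1) → ℕ) → ℕ)
    (h3 : ∀ v : Fin (n+1) → ℕ, (∀ i, v i ≤ M) → ∀ i : Fin _, v i = M → l v ≠ (i:ℕ) + 1) :
    ((kface (n+1) M l).card : ZMod 2) = ((kface (n+1) M l).filter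
      fun s => s.2 = 0 ∧ ∃ i, s.1.2 i = 0 ∧ s.1.1 i = 0).card := by
  classical
  rw [← Finset.card_filter_add_card_filter_not (s := kface (n+1) M l)
    (fun s => s.2 = 0 ∧ ∃ i, s.1.2 i = 0 ∧ s.1.1 i = 0)]
  push_cast
  rw [add_eq_left, Finset.card_eq_sum_ones]
  push_cast
  refine Finset.sum_involution (fun s _ => kinv n s) ?_ ?_ ?_ ?_
  · intros; decide
  · intro s hs _
    rw [Finset.mem_filter] at hs
    refine kinv_ne n s ?_
    have := hs.1
    simp only [kface, Finset.mem_filter, Finset.mem_product, Finset.mem_range] at this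
    exact this.1.2
  · intro s hs
    rw [Finset.mem_filter] at hs ⊢
    exact kinv_mem n M hM l h3 s hs.1 hs.2
  · intro s hs
    rw [Finset.mem_filter] at hs
    exact kinv_kinv n M l s hs.1 hs.2

lemma kv_decompose (n : ℕ) (v : Fin (n+1) → ℕ) (e : Equiv.Perm (Fin n)) (hv : v 0 = 0) (j : ℕ) :
    kv v (Equiv.Perm.decomposeFin.symm (0, e)) (j+1) = Fin.cons 0 (kv (Fin.tail v) e j) := by
  funext i
  refine Fin.cases ?_ (fun i => ?_) i
  · simp [kv, hv]
  · simp [kv, Fin.tail]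

lemma face_shift (n : ℕ) (a : ℕ → ℕ) (ha : ∀ j ≤ n, 1 ≤ a (j+1)) :
    ((Finset.range (n+1+1)).erase 0).image a = Finset.Icc 1 (n+1) ↔
      (Finset.range (n+1)).image (fun j => a (j+1) - 1) = Finset.range (n+1) := by
  simp only [Finset.ext_iff, Finset.mem_image, Finset.mem_erase, Finset.mem_range, Finset.mem_Icc]
  constructor
  · intro h x
    rw [show (x < n + 1) ↔ (1 ≤ x+1 ∧ x+1 ≤ n + 1) by omega, ← h]
    constructor
    · rintro ⟨j, hj, rfl⟩
      exact ⟨j+1, ⟨by omega, by omega⟩, by have := ha j (by omega); omega⟩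
    · rintro ⟨j, ⟨hj, hj'⟩, hx⟩
      refine ⟨j-1, by omega, ?_⟩
      rw [show j - 1 + 1 = j by omega]; omega
  · intro h x
    constructor
    · rintro ⟨j, ⟨hj, hj'⟩, rfl⟩
      have h1 := (h (a j - 1)).1 ⟨j-1, by omega, by rw [show j - 1 + 1 = j by omega]⟩
      have h2 := ha (j-1) (by omega)
      rw [show j - 1 + 1 = j by omega] at h2
      omega
    · rintro ⟨h1, h2⟩
      obtain ⟨j, hj, hx⟩ := (h (x-1)).2 (by omega)
      exact ⟨j+1, ⟨by omega, by omega⟩, by have := ha j (by omega); omega⟩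

lemma kuhn (N M : ℕ) (hM : 0 < M) (l : (Fin N → ℕ) → ℕ)
    (h1 : ∀ v, (∀ i, v i ≤ M) → l v ≤ N)
    (h2 : ∀ v, (∀ i, v i ≤ M) → ∀ i : Fin _, v i = 0 → (i:ℕ) + 1 ≤ l v)
    (h3 : ∀ v, (∀ i, v i ≤ M) → ∀ i : Fin _, v i = M → l v ≠ (i:ℕ) + 1) :
    ((kfull N M l).card : ZMod 2) = 1 := by
  classical
  induction N with
  | zero =>
    have : kfull 0 M l = Finset.univ := by
      ext s
      simp only [kfull, Finset.mem_filter, Finset.mem_univ, iff_true]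
      refine ⟨Finset.mem_product.2 ⟨Fintype.mem_piFinset.2 fun i => i.elim0, Finset.mem_univ _⟩, ?_⟩
      have := h1 (kv s.1 s.2 0) (fun i => i.elim0)
      simp at this ⊢
      exact this
    rw [this]; simp
  | succ n ih =>
    rw [kfull_kface _ _ _ h1, kface_boundary n M hM l h3]
    rw [← ih (fun u => l (Fin.cons 0 u) - 1) ?_ ?_ ?_]
    · have hcle : ∀ v : Fin n → ℕ, (∀ i, v i ≤ M) → ∀ i, (Fin.cons 0 v : Fin (n+1) → ℕ) i ≤ M :=
        fun v hv i => by refine Fin.cases ?_ (fun i => ?_) i <;> simp [hv]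
      have key : ∀ (v : Fin (n+1) → ℕ) (e : Equiv.Perm (Fin n)), v 0 = 0 →
          (∀ i, Fin.tail v i < M) →
          (((Finset.range (n+1+1)).erase 0).image
            (fun j => l (kv v (Equiv.Perm.decomposeFin.symm (0, e)) j)) = Finset.Icc 1 (n+1) ↔
          (Finset.range (n+1)).image (fun j => l (Fin.cons 0 (kv (Fin.tail v) e j)) - 1)
            = Finset.range (n+1)) := by
        intro v e hv0 hv
        rw [face_shift n (fun j => l (kv v (Equiv.Perm.decomposeFin.symm (0, e)) j))]
        · simp only [kv_decompose n v e hv0]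
        · intro j _
          rw [kv_decompose n v e hv0]
          have := h2 (Fin.cons 0 (kv (Fin.tail v) e j))
            (hcle _ (fun i => kv_le (by simpa using hv) i)) 0 (by simp)
          omega
      congr 1
      symm
      apply Finset.card_nbij
        (fun s : (Fin n → ℕ) × Equiv.Perm (Fin n) =>
          (((Fin.cons 0 s.1 : Fin (n+1) → ℕ), Equiv.Perm.decomposeFin.symm (0, s.2)), 0))
      · rintro ⟨v, e⟩ hs
        simp only [kfull, kface, Finset.coe_filter, Finset.mem_filter, Finset.mem_product,
          Finset.mem_range,
          Fintype.mem_piFinset, Finset.mem_univ, and_true, Set.mem_ofPred_eq] at hs ⊢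
        refine ⟨⟨⟨?_, by omega⟩, ?_⟩, trivial, 0, by simp, by simp⟩
        · intro i; refine Fin.cases ?_ (fun i => ?_) i <;> simp [hM, hs.1]
        · rw [key _ _ (by simp) (by simpa using hs.1)]
          simpa using hs.2
      · rintro ⟨v, e⟩ _ ⟨v', e'⟩ _ h
        simp only [Prod.mk.injEq, Fin.cons_inj, true_and, and_true, EmbeddingLike.apply_eq_iff_eq] at h
        exact Prod.ext h.1 h.2
      · rintro ⟨⟨v, π⟩, j⟩ hs
        simp only [kface, Finset.coe_filter, Finset.mem_filter, Finset.mem_product,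
          Finset.mem_range,
          Fintype.mem_piFinset, Finset.mem_univ, and_true, Set.mem_ofPred_eq] at hs
        obtain ⟨⟨⟨hv, hj⟩, hf⟩, rfl, i, hi, hvi⟩ := hs
        have hi0 : i = 0 := by
          have hm : 1 ∈ Finset.Icc 1 (n+1) := by simp
          rw [← hf] at hm
          obtain ⟨j, hj, hjl⟩ := Finset.mem_image.1 hm
          simp only [Finset.mem_erase, Finset.mem_range] at hj
          have := h2 (kv v π j) (fun i' => kv_le (by simpa using hv) i') i (by
            simp [kv, hvi, hi, hj.1])
          apply Fin.ext
          simp only [Fin.coe_ofNat_eq_mod, Nat.zero_mod]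
          omega
        subst hi0
        obtain ⟨⟨p, e⟩, rfl⟩ := Equiv.Perm.decomposeFin.symm.surjective π
        have hp : p = 0 := by simpa using hi
        subst hp
        refine ⟨(Fin.tail v, e), ?_, ?_⟩
        · simp only [kfull, Finset.coe_filter, Finset.mem_product,
            Fintype.mem_piFinset, Finset.mem_univ, and_true, Set.mem_ofPred_eq]
          refine ⟨fun i => Finset.mem_range.2 (hv i.succ), ?_⟩
          exact (key v e hvi (fun i => hv i.succ)).1 hf
        · simp only [Prod.mk.injEq, and_true]
          conv_rhs => rw [← Fin.cons_self_tail v, hvi]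
    · intro v hv
      have := h1 (Fin.cons 0 v) (fun i => by refine Fin.cases ?_ (fun i => ?_) i <;> simp [hv])
      omega
    · intro v hv i hi
      have := h2 (Fin.cons 0 v) (fun i => by refine Fin.cases ?_ (fun i => ?_) i <;> simp [hv])
        i.succ (by simpa using hi)
      simp only [Fin.val_succ] at *; omega
    · intro v hv i hi
      have hle : ∀ i, (Fin.cons 0 v : Fin (n+1) → ℕ) i ≤ M :=
        fun i => by refine Fin.cases ?_ (fun i => ?_) i <;> simp [hv]
      have := h3 (Fin.cons 0 v) hle i.succ (by simpa using hi)
      have := h2 (Fin.cons 0 v) hle 0 (by simp)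
      simp only [Fin.val_succ] at *; omega


/-- Grid point of the cube. -/
noncomputable def gpt (N M : ℕ) (v : Fin N → ℕ) : Fin N → unitInterval :=
  fun i => ⟨min ((v i : ℝ) / M) 1, le_min (by positivity) zero_le_one, min_le_right _ _⟩

theorem lebesgue_cover (N : ℕ) {κ : Type} [Finite κ] (V : κ → Set (Fin N → unitInterval))
    (hV : ∀ j, IsOpen (V j)) (hc : (⋃ j, V j) = Set.univ)
    (ho : ∀ x, Set.ncard {j | x ∈ V j} ≤ N) :
    ∃ j i x y, x ∈ V j ∧ y ∈ V j ∧ x i = 0 ∧ y i = 1 := by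
  classical
  by_contra H
  push Not at H
  obtain ⟨δ, hδ, hcol⟩ := lebesgue_number_lemma_of_metric (isCompact_univ) hV (by rw [hc])
  have hcol' : ∀ x, ∃ j, Metric.ball x δ ⊆ V j := fun x => hcol x (mem_univ x)
  choose col hcol using hcol'
  obtain ⟨M', hM'⟩ := exists_nat_one_div_lt hδ
  set M := M' + 1 with hMdef
  have hM : 0 < M := by omega
  have hMR : (0:ℝ) < M := by exact_mod_cast hM
  have hMδ : 1 / (M:ℝ) < δ := by rw [hMdef]; push_cast; exact hM'
  have hself : ∀ v, gpt N M v ∈ V (col (gpt N M v)) := fun v => hcol _ (Metric.mem_ball_self hδ)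
  set lc : κ → ℕ := fun c =>
    Finset.univ.sup fun i : Fin N => if ∃ y ∈ V c, y i = 1 then 0 else (i:ℕ) + 1 with hlc
  set l : (Fin N → ℕ) → ℕ := fun v => lc (col (gpt N M v)) with hl
  have hk := kuhn N M hM l ?_ ?_ ?_
  · have hne : (kfull N M l).Nonempty := by
      rw [Finset.nonempty_iff_ne_empty]
      intro h
      rw [h] at hk; simp at hk
    obtain ⟨⟨v, π⟩, hs⟩ := hne
    simp only [kfull, Finset.mem_filter, Finset.mem_product, Finset.mem_univ, and_true] at hs
    obtain ⟨hv, hfull⟩ := hs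
    have hinj : Set.InjOn (fun j => l (kv v π j)) (Finset.range (N+1)) := by
      apply Finset.injOn_of_card_image_eq
      rw [hfull]
    have hinj2 : Set.InjOn (fun j => col (gpt N M (kv v π j))) (Finset.range (N+1)) := by
      intro a ha b hb hab
      apply hinj ha hb
      simp only [hl]
      simp only at hab
      rw [hab]
    have hsub : ((Finset.range (N+1)).image (fun j => col (gpt N M (kv v π j))) : Set κ) ⊆
        {j | gpt N M (kv v π N) ∈ V j} := by
      intro c hc
      simp only [Finset.coe_image, Set.mem_image] at hc
      obtain ⟨j, -, rfl⟩ := hc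
      apply hcol
      rw [Metric.mem_ball, dist_pi_lt_iff hδ]
      intro i
      have h1 : (kv v π N i : ℝ) / M ≤ 1 := by
        rw [div_le_one hMR]; exact_mod_cast kv_le hv i
      have h2 : (kv v π j i : ℝ) / M ≤ 1 := by
        rw [div_le_one hMR]; exact_mod_cast kv_le hv i
      rw [Subtype.dist_eq]
      simp only [gpt, min_eq_left h1, min_eq_left h2]
      refine lt_of_le_of_lt ?_ hMδ
      rw [Real.dist_eq, ← sub_div, abs_div, abs_of_pos hMR]
      apply div_le_div_of_nonneg_right _ hMR.le
      unfold kv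
      rw [if_neg (by have := (π i).isLt; omega)]
      split_ifs <;> simp
    have h3 := Set.ncard_le_ncard hsub (Set.toFinite _)
    rw [Set.ncard_coe_finset, Finset.card_image_of_injOn hinj2, Finset.card_range] at h3
    have := ho (gpt N M (kv v π N))
    omega
  · intro v _
    simp only [hl, hlc]
    apply Finset.sup_le
    intro i _
    split_ifs <;> omega
  · intro v hv i hi
    simp only [hl, hlc]
    have hn : ¬ ∃ y ∈ V (col (gpt N M v)), y i = 1 := by
      rintro ⟨y, hy, hy1⟩
      refine H _ i _ y (hself v) hy ?_ hy1
      apply Subtype.ext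
      simp [gpt, hi]
    have := Finset.le_sup (s := Finset.univ) (f := fun i : Fin N =>
      if ∃ y ∈ V (col (gpt N M v)), y i = 1 then 0 else (i:ℕ) + 1) (Finset.mem_univ i)
    simp only [hn, if_false] at this
    exact this
  · intro v hv i hi heq
    simp only [hl, hlc] at heq
    obtain ⟨i', -, hi'⟩ := Finset.exists_mem_eq_sup Finset.univ ⟨i, Finset.mem_univ i⟩
      (fun i : Fin N => if ∃ y ∈ V (col (gpt N M v)), y i = 1 then 0 else (i:ℕ) + 1)
    rw [heq] at hi'
    have hy : ∃ y ∈ V (col (gpt N M v)), y i = 1 := by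
      refine ⟨_, hself v, ?_⟩
      apply Subtype.ext
      simp [gpt, hi, hMR.ne']
    by_cases h : ∃ y ∈ V (col (gpt N M v)), y i' = 1
    · simp only [h, if_true] at hi'; omega
    · simp only [h, if_false] at hi'
      have : i = i' := Fin.ext (by omega)
      subst this
      exact h hy

theorem embed_dim {J P : Type} [Fintype J] [MetricSpace P] [CompactSpace P]
    (φ : (J → unitInterval) → P) (hφ : Continuous φ)
    (h : ∀ u v, φ u = φ v → ∀ j, u j = 0 → v j ≠ 1) {m : ℕ} (hm : covDimLE P m) :
    Fintype.card J ≤ m := by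
  classical
  by_contra hlt
  push Not at hlt
  set face : J → Bool → Set P := fun j b => φ '' {u | u j = if b then 1 else 0} with hface
  have hcl : ∀ j b, IsClosed (face j b) := by
    intro j b
    apply IsCompact.isClosed
    apply IsCompact.image _ hφ
    apply IsClosed.isCompact
    exact isClosed_eq (continuous_apply j) continuous_const
  have hdisj : ∀ j p, p ∈ face j false → p ∉ face j true := by
    rintro j p ⟨u, hu, rfl⟩ ⟨v, hv, hvu⟩
    exact h u v hvu.symm j (by simpa using hu) (by simpa using hv)
  obtain ⟨κ, V, hκ, hVo, hVc, hVr, hVn⟩ := hm (J → Bool) (fun σ => ⋂ j, (face j (σ j))ᶜ)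
    inferInstance (fun σ => isOpen_iInter_of_finite fun j => (hcl j _).isOpen_compl) (by
      rw [eq_univ_iff_forall]
      intro p
      rw [mem_iUnion]
      refine ⟨fun j => decide (p ∈ face j false), ?_⟩
      rw [mem_iInter]
      intro j
      by_cases hp : p ∈ face j false
      · simp only [hp, decide_true]; exact hdisj j p hp
      · simp only [hp, decide_false]; exact hp)
  let e := Fintype.equivFin J
  let ψ : (Fin (Fintype.card J) → unitInterval) → P := fun x => φ (fun j => x (e j))
  have hψ : Continuous ψ := hφ.comp (by fun_prop)
  obtain ⟨j, i, x, y, hx, hy, hx0, hy1⟩ := lebesgue_cover (Fintype.card J) (fun j => ψ ⁻¹' V j)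
    (fun j => (hVo j).preimage hψ) (by rw [← preimage_iUnion, hVc, preimage_univ])
    (fun x => (hVn (ψ x)).trans (by omega))
  obtain ⟨σ, hσ⟩ := hVr j
  have hx' := mem_iInter.1 (hσ hx) (e.symm i)
  have hy' := mem_iInter.1 (hσ hy) (e.symm i)
  have hxf : ψ x ∈ face (e.symm i) false := ⟨_, by simp [hx0], rfl⟩
  have hyf : ψ y ∈ face (e.symm i) true := ⟨_, by simp [hy1], rfl⟩
  cases hσi : σ (e.symm i)
  · rw [hσi] at hx'; exact hx' hxf
  · rw [hσi] at hy'; exact hy' hyf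


/-- The cube has covering dimension at most its number of coordinates. -/
theorem covDim_cube (J : Type) [Fintype J] : covDimLE (J → unitInterval) (Fintype.card J) := by
  classical
  intro ι U hι hUo hUc
  obtain ⟨δ, hδ, hU⟩ := lebesgue_number_lemma_of_metric (isCompact_univ) hUo (by rw [hUc])
  set n := Fintype.card J with hn
  obtain ⟨M', hM'⟩ := exists_nat_one_div_lt hδ
  set M : ℕ := M' + 1 with hMdef
  have hMR : (0:ℝ) < M := by rw [hMdef]; positivity
  have hMδ : 1 / (M:ℝ) < δ := by rw [hMdef]; push_cast; exact hM'
  -- offsets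
  let off : Fin (n+1) → ℝ := fun c => (c:ℝ) / (n+1)
  have hoff0 : ∀ c, 0 ≤ off c := fun c => by positivity
  have hoff1 : ∀ c, off c < 1 := fun c => by
    show (c:ℝ) / (n+1) < 1
    rw [div_lt_one (by positivity)]
    exact_mod_cast c.isLt
  -- cells
  let V : Fin (n+1) × (J → Fin (M+2)) → Set (J → unitInterval) := fun p =>
    {x | ∀ j, (p.2 j : ℝ) - 1 + off p.1 < M * (x j : ℝ) ∧ M * (x j : ℝ) < (p.2 j : ℝ) + off p.1}
  have hVo : ∀ p, IsOpen (V p) := by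
    intro p
    have : V p = ⋂ j, {x : J → unitInterval | (p.2 j : ℝ) - 1 + off p.1 < M * (x j : ℝ) ∧
        M * (x j : ℝ) < (p.2 j : ℝ) + off p.1} := by ext x; simp [V]
    rw [this]
    apply isOpen_iInter_of_finite
    intro j
    have h1 : IsOpen {x : J → unitInterval | (p.2 j : ℝ) - 1 + off p.1 < M * (x j : ℝ)} :=
      isOpen_lt (by fun_prop) (by fun_prop)
    have h2 : IsOpen {x : J → unitInterval | M * (x j : ℝ) < (p.2 j : ℝ) + off p.1} :=
      isOpen_lt (by fun_prop) (by fun_prop)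
    exact h1.inter h2
  have huniq : ∀ x p q, x ∈ V p → x ∈ V q → p.1 = q.1 → p = q := by
    intro x p q hp hq h
    refine Prod.ext h (funext fun j => Fin.ext ?_)
    have h1 := hp j
    have h2 := hq j
    rw [h] at h1
    have a : (p.2 j : ℝ) < (q.2 j : ℝ) + 1 := by linarith
    have b : (q.2 j : ℝ) < (p.2 j : ℝ) + 1 := by linarith
    have a' : (p.2 j : ℕ) < (q.2 j : ℕ) + 1 := by exact_mod_cast a
    have b' : (q.2 j : ℕ) < (p.2 j : ℕ) + 1 := by exact_mod_cast b
    omega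
  have hcover : ∀ x, ∃ p, x ∈ V p := by
    intro x
    -- choose an offset avoiding all coordinates
    have : ∃ c : Fin (n+1), ∀ j, Int.fract ((M:ℝ) * x j) ≠ off c := by
      by_contra hcon
      push Not at hcon
      choose f hf using hcon
      have hinj : Function.Injective f := by
        intro c d hcd
        have h1 := hf c
        have h2 := hf d
        rw [hcd, h2] at h1
        have h3 : (d:ℝ) / (n+1) = (c:ℝ) / (n+1) := h1
        rw [div_left_inj' (by positivity)] at h3
        exact Fin.ext (by exact_mod_cast h3.symm)
      have := Fintype.card_le_of_injective f hinj
      simp [← hn] at this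
    obtain ⟨c, hc⟩ := this
    have hx0 : ∀ j, 0 ≤ (M:ℝ) * x j := fun j => mul_nonneg hMR.le (x j).2.1
    have hx1 : ∀ j, (M:ℝ) * x j ≤ M := fun j => by
      have := (x j).2.2
      nlinarith
    have hfl : ∀ j, ⌊(M:ℝ) * x j⌋₊ ≤ M := fun j => by
      have := Nat.floor_mono (hx1 j)
      simpa using this
    refine ⟨(c, fun j => if Int.fract ((M:ℝ) * x j) < off c then
      ⟨⌊(M:ℝ) * x j⌋₊, by have := hfl j; omega⟩
      else ⟨⌊(M:ℝ) * x j⌋₊ + 1, by have := hfl j; omega⟩), ?_⟩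
    intro j
    have h1 : ((⌊(M:ℝ) * x j⌋₊ : ℕ) : ℝ) + Int.fract ((M:ℝ) * x j) = (M:ℝ) * x j := by
      rw [natCast_floor_eq_intCast_floor (hx0 j)]
      exact Int.floor_add_fract _
    have h2 := Int.fract_nonneg ((M:ℝ) * x j)
    have h3 := Int.fract_lt_one ((M:ℝ) * x j)
    have h4 := hoff0 c
    have h5 := hoff1 c
    by_cases hlt : Int.fract ((M:ℝ) * x j) < off c
    · simp only [hlt, if_true]
      constructor <;> linarith
    · have h6 : off c < Int.fract ((M:ℝ) * x j) := lt_of_le_of_ne (not_lt.1 hlt) (hc j).symm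
      simp only [hlt, if_false]
      push_cast
      constructor <;> linarith
  refine ⟨{p // (V p).Nonempty}, fun p => V p.1, inferInstance, fun p => hVo _, ?_, ?_, ?_⟩
  · rw [eq_univ_iff_forall]
    intro x
    obtain ⟨p, hp⟩ := hcover x
    exact mem_iUnion.2 ⟨⟨p, x, hp⟩, hp⟩
  · rintro ⟨p, x, hx⟩
    obtain ⟨i, hi⟩ := hU x (mem_univ x)
    refine ⟨i, fun y hy => hi ?_⟩
    rw [Metric.mem_ball]
    refine lt_of_le_of_lt ?_ hMδ
    rw [dist_pi_le_iff (by positivity)]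
    intro j
    rw [Subtype.dist_eq, Real.dist_eq, le_div_iff₀ hMR, ← abs_of_pos hMR, ← abs_mul, abs_le]
    have h1 := hx j
    have h2 := hy j
    constructor <;> nlinarith
  · intro x
    have : Set.ncard {p : {p // (V p).Nonempty} | x ∈ V p.1} ≤ (Set.univ : Set (Fin (n+1))).ncard := by
      apply Set.ncard_le_ncard_of_injOn (fun p => p.1.1) (fun _ _ => mem_univ _)
      · intro p hp q hq h
        exact Subtype.ext (huniq x _ _ hp hq h)
    simpa [Set.ncard_univ] using this

theorem topDim_cube (J : Type) [Fintype J] :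
    topDim (J → unitInterval) ≤ (Fintype.card J : ENNReal) :=
  sInf_le ⟨_, rfl, covDim_cube J⟩

/-! ### Compatible metrics -/

lemma compat_continuous {Y : Type} [TopologicalSpace Y] {ρ : Y → Y → ℝ} (h : IsCompatMetric ρ) :
    Continuous fun p : Y × Y => ρ p.1 p.2 := by
  obtain ⟨h0, hs, ht, hn⟩ := h
  rw [continuous_iff_continuousAt]
  rintro ⟨a, b⟩
  rw [ContinuousAt, Metric.tendsto_nhds]
  intro ε hε
  have ha : {y | ρ a y < ε/2} ∈ 𝓝 a := (hn a _).2 ⟨ε/2, by positivity, subset_rfl⟩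
  have hb : {y | ρ b y < ε/2} ∈ 𝓝 b := (hn b _).2 ⟨ε/2, by positivity, subset_rfl⟩
  filter_upwards [prod_mem_nhds ha hb]
  rintro ⟨x, y⟩ ⟨hx, hy⟩
  simp only [Set.mem_ofPred_eq] at hx hy
  rw [Real.dist_eq, abs_lt]
  have := ht x a y
  have := ht a b y
  have := ht a x b
  have := ht x y b
  have := hs x a
  have := hs y b
  constructor <;> simp only <;> linarith

lemma compat_sep {G : Type} {ρ : (G → unitInterval) → (G → unitInterval) → ℝ}
    (h : IsCompatMetric ρ) (g : G) {η : ℝ} (hη : 0 < η) :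
    ∃ ε > 0, ∀ x y, ρ x y ≤ ε → |(x g : ℝ) - y g| < η := by
  have hcont := compat_continuous h
  obtain ⟨h0, hs, ht, hn⟩ := h
  let C : Set ((G → unitInterval) × (G → unitInterval)) := {p | η ≤ |(p.1 g : ℝ) - p.2 g|}
  have hC : IsCompact C := (isClosed_le (by fun_prop) (by fun_prop)).isCompact
  have hnn : ∀ x y, 0 ≤ ρ x y := fun x y => by
    have h1 := ht x y x
    rw [(h0 x x).2 rfl, hs y x] at h1; linarith
  rcases C.eq_empty_or_nonempty with hE | hne
  · refine ⟨1, one_pos, fun x y _ => ?_⟩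
    by_contra hc
    have : (x, y) ∈ C := not_lt.1 hc
    rw [hE] at this; exact this
  · obtain ⟨p, hp, hmin⟩ := hC.exists_isMinOn hne hcont.continuousOn
    have hpos : 0 < ρ p.1 p.2 := by
      refine lt_of_le_of_ne (hnn _ _) (fun h => ?_)
      have := (h0 _ _).1 h.symm
      have h2 : η ≤ |(p.1 g : ℝ) - p.2 g| := hp
      rw [this] at h2; simp at h2; linarith
    refine ⟨ρ p.1 p.2 / 2, by positivity, fun x y hxy => ?_⟩
    by_contra hc
    have : (x, y) ∈ C := not_lt.1 hc
    have := hmin this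
    simp only [Set.mem_ofPred_eq] at this
    linarith

lemma compat_window {G : Type} {ρ : (G → unitInterval) → (G → unitInterval) → ℝ}
    (h : IsCompatMetric ρ) {ε : ℝ} (hε : 0 < ε) :
    ∃ K : Finset G, ∀ x y, (∀ k ∈ K, x k = y k) → ρ x y ≤ ε := by
  classical
  have hcont := compat_continuous h
  obtain ⟨h0, hs, ht, hn⟩ := h
  let C : Finset G → Set ((G → unitInterval) × (G → unitInterval)) :=
    fun K => {p | ε ≤ ρ p.1 p.2} ∩ ⋂ k ∈ K, {p | p.1 k = p.2 k}
  have hCc : ∀ K, IsClosed (C K) := fun K =>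
    (isClosed_le continuous_const hcont).inter
      (isClosed_biInter fun k _ => isClosed_eq (by fun_prop) (by fun_prop))
  by_contra hcon
  push Not at hcon
  have hne : (⋂ K, C K).Nonempty := by
    apply IsCompact.nonempty_iInter_of_directed_nonempty_isCompact_isClosed
    · intro K L
      refine ⟨K ∪ L, ?_, ?_⟩
      · rintro p ⟨h1, h2⟩
        refine ⟨h1, ?_⟩
        simp only [mem_iInter] at h2 ⊢
        exact fun k hk => h2 k (Finset.mem_union_left _ hk)
      · rintro p ⟨h1, h2⟩
        refine ⟨h1, ?_⟩
        simp only [mem_iInter] at h2 ⊢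
        exact fun k hk => h2 k (Finset.mem_union_right _ hk)
    · intro K
      obtain ⟨x, y, hxy, hlt⟩ := hcon K
      exact ⟨(x, y), hlt.le, by simpa using hxy⟩
    · exact fun K => (hCc K).isCompact
    · exact hCc
  obtain ⟨p, hp⟩ := hne
  rw [mem_iInter] at hp
  have : p.1 = p.2 := by
    funext k
    have := (hp {k}).2
    simpa using this
  have h1 : ε ≤ ρ p.1 p.2 := (hp ∅).1
  rw [this, (h0 _ _).2 rfl] at h1
  linarith


/-! ### A translation invariant Boolean algebra of subsets whose nonempty members are syndetic -/

/-- A Boolean algebra of subsets of `G`, invariant under left translations, all of whose nonempty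
members are syndetic, and which separates points in a strong sense. -/
structure SynAlg {G : Type} [Group G] (B : Set (Set G)) : Prop where
  univ_mem : univ ∈ B
  inter_mem : ∀ S ∈ B, ∀ T ∈ B, S ∩ T ∈ B
  compl_mem : ∀ S ∈ B, Sᶜ ∈ B
  trans_mem : ∀ g : G, ∀ S ∈ B, {h | g * h ∈ S} ∈ B
  synd : ∀ S ∈ B, S.Nonempty → ∃ T : Finset G, ∀ h, ∃ t ∈ T, t * h ∈ S
  sep : ∀ d : G, d ≠ 1 → ∀ s : G, ∃ S ∈ B, s ∈ S ∧ ∀ x ∈ S, d * x ∉ S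

/-- left invariance of a filter -/
def LInv {G : Type} [Group G] (F : Filter G) : Prop :=
  ∀ g : G, ∀ A ∈ F, {h | g * h ∈ A} ∈ F

lemma exists_min_linv (G : Type) [Group G] :
    ∃ F : Filter G, F.NeBot ∧ LInv F ∧ ∀ F' : Filter G, F'.NeBot → LInv F' → F' ≤ F → F' = F := by
  obtain ⟨m, hm⟩ := zorn_le₀ (α := (Filter G)ᵒᵈ)
    {F | (OrderDual.ofDual F).NeBot ∧ LInv (OrderDual.ofDual F)} (by
    intro c hc hchain
    rcases c.eq_empty_or_nonempty with rfl | hne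
    · refine ⟨OrderDual.toDual ⊤, ⟨?_, ?_⟩, by simp⟩
      · simp; infer_instance
      · intro g A hA
        simp at hA
        subst hA
        simp
    · have hdir : DirectedOn (fun x y : Filter G => x ≥ y) (OrderDual.ofDual '' c) := by
        rintro _ ⟨x, hx, rfl⟩ _ ⟨y, hy, rfl⟩
        rcases hchain.total hx hy with h | h
        · exact ⟨_, ⟨y, hy, rfl⟩, h, le_refl _⟩
        · exact ⟨_, ⟨x, hx, rfl⟩, le_refl _, h⟩
      refine ⟨OrderDual.toDual (sInf (OrderDual.ofDual '' c)), ⟨?_, ?_⟩, ?_⟩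
      · apply Filter.sInf_neBot_of_directed' (hne.image _) hdir
        rintro ⟨x, hx, h⟩
        exact (hc hx).1.ne h
      · intro g A hA
        rw [OrderDual.ofDual_toDual, sInf_eq_iInf, Filter.mem_biInf_of_directed hdir (hne.image _)]
          at hA ⊢
        obtain ⟨_, ⟨x, hx, rfl⟩, hA⟩ := hA
        exact ⟨_, ⟨x, hx, rfl⟩, (hc hx).2 g A hA⟩
      · intro z hz
        exact sInf_le (α := Filter G) ⟨z, hz, rfl⟩)
  refine ⟨OrderDual.ofDual m, hm.1.1, hm.1.2, fun F' h1 h2 h3 => ?_⟩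
  exact le_antisymm h3 (hm.2 (y := OrderDual.toDual F') ⟨h1, h2⟩ h3)

/-- the Boolean homomorphism attached to an ultrafilter -/
def starSet {G : Type} [Group G] (p : Ultrafilter G) (A : Set G) : Set G :=
  {g | {h | g * h ∈ A} ∈ p}

lemma synd_aux {G : Type} [Group G] {F : Filter G} (hI : LInv F)
    (hmin : ∀ F' : Filter G, F'.NeBot → LInv F' → F' ≤ F → F' = F) (p : Ultrafilter G)
    (hp : (p : Filter G) ≤ F) (A : Set G) (hA : A ∈ p) :
    ∃ T : Finset G, ∀ h, ∃ t ∈ T, t * h ∈ starSet p A := by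
  classical
  by_contra hcon
  push Not at hcon
  let F' : Filter G :=
    { sets := {D | ∃ T : Finset G, ∃ C ∈ F, C ∩ {x | ∀ t ∈ T, t * x ∉ A} ⊆ D}
      univ_sets := ⟨∅, univ, univ_mem, subset_univ _⟩
      sets_of_superset := by
        rintro D D' ⟨T, C, hC, h⟩ h'
        exact ⟨T, C, hC, h.trans h'⟩
      inter_sets := by
        rintro D D' ⟨T, C, hC, h⟩ ⟨T', C', hC', h'⟩
        refine ⟨T ∪ T', C ∩ C', inter_mem hC hC', ?_⟩
        rintro x ⟨⟨h1, h2⟩, h3⟩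
        exact ⟨h ⟨h1, fun t ht => h3 t (Finset.mem_union_left _ ht)⟩,
          h' ⟨h2, fun t ht => h3 t (Finset.mem_union_right _ ht)⟩⟩ }
  have hmem : ∀ D, D ∈ F' ↔ ∃ T : Finset G, ∃ C ∈ F, C ∩ {x | ∀ t ∈ T, t * x ∉ A} ⊆ D :=
    fun D => Iff.rfl
  have hne : F'.NeBot := by
    rw [← Filter.empty_mem_iff_bot.not.trans Filter.neBot_iff.symm, hmem]
    rintro ⟨T, C, hC, h⟩
    obtain ⟨y, hy⟩ := hcon T
    have h1 : {x | y * x ∈ C} ∈ p := hp (hI y C hC)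
    have h2 : ∀ t ∈ T, {x | t * y * x ∈ A}ᶜ ∈ p := fun t ht =>
      Ultrafilter.compl_mem_iff_notMem.2 (hy t ht)
    have h3 : (⋂ t ∈ T, {x | t * y * x ∈ A}ᶜ) ∈ (p : Filter G) :=
      (Filter.biInter_finset_mem T).2 h2
    obtain ⟨x, hx1, hx2⟩ := p.nonempty_of_mem (inter_mem h1 h3)
    refine (h ⟨hx1, ?_⟩ : y * x ∈ (∅ : Set G))
    intro t ht
    simp only [mem_iInter] at hx2
    have := hx2 t ht
    rwa [mem_compl_iff, Set.mem_ofPred_eq, mul_assoc] at this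
  have hinv : LInv F' := by
    rintro g D ⟨T, C, hC, h⟩
    refine ⟨T.image (· * g), {x | g * x ∈ C}, hI g C hC, ?_⟩
    rintro x ⟨h1, h2⟩
    refine h ⟨h1, fun t ht => ?_⟩
    have := h2 (t * g) (Finset.mem_image_of_mem _ ht)
    rwa [mul_assoc] at this
  have hle : F' ≤ F := fun C hC => ⟨∅, C, hC, inter_subset_left⟩
  have heq := hmin F' hne hinv hle
  have : Aᶜ ∈ F' := ⟨{1}, univ, univ_mem, by
    rintro x ⟨_, h⟩
    simpa using h⟩
  rw [heq] at this
  exact Ultrafilter.compl_mem_iff_notMem.1 (hp this) hA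

lemma exists_synAlg (G : Type) [Group G] : ∃ B : Set (Set G), SynAlg B := by
  classical
  obtain ⟨F, hne, hI, hmin⟩ := exists_min_linv G
  obtain ⟨p, hp⟩ := Ultrafilter.exists_le F
  refine ⟨range (starSet p), ?_, ?_, ?_, ?_, ?_, ?_⟩
  · refine ⟨univ, ?_⟩
    ext x
    simp only [starSet, mem_univ, iff_true]
    exact (univ_mem : univ ∈ (p : Filter G))
  · rintro _ ⟨S, rfl⟩ _ ⟨T, rfl⟩
    refine ⟨S ∩ T, ?_⟩
    ext x
    simp only [starSet, Set.mem_ofPred_eq, Set.mem_inter_iff]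
    exact Filter.inter_mem_iff (f := (p : Filter G)) (s := {h | x * h ∈ S}) (t := {h | x * h ∈ T})
  · rintro _ ⟨S, rfl⟩
    refine ⟨Sᶜ, ?_⟩
    ext x
    exact Ultrafilter.compl_mem_iff_notMem (f := p) (s := {h | x * h ∈ S})
  · rintro g _ ⟨S, rfl⟩
    refine ⟨{h | g * h ∈ S}, ?_⟩
    ext x
    simp [starSet, mul_assoc]
  · rintro _ ⟨S, rfl⟩ ⟨s, hs⟩
    obtain ⟨T, hT⟩ := synd_aux hI hmin p hp {h | s * h ∈ S} hs
    refine ⟨T.image (s * ·), fun h => ?_⟩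
    obtain ⟨t, ht, hth⟩ := hT h
    refine ⟨s * t, Finset.mem_image_of_mem _ ht, ?_⟩
    simpa [starSet, mul_assoc] using hth
  · intro d hd s
    obtain ⟨A, hA⟩ := zorn_subset {A : Set G | ∀ x ∈ A, d * x ∉ A} (by
      intro c hc hchain
      refine ⟨⋃₀ c, ?_, fun S hS => subset_sUnion_of_mem hS⟩
      rintro x ⟨S, hS, hx⟩ ⟨S', hS', hx'⟩
      rcases hchain.total hS hS' with h | h
      · exact hc hS' x (h hx) hx'
      · exact hc hS x hx (h hx'))
    have hAd : ∀ x ∈ A, d * x ∉ A := hA.1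
    have hcov : ∀ g, g ∈ A ∨ d * g ∈ A ∨ d⁻¹ * g ∈ A := by
      intro g
      by_contra hcon
      push Not at hcon
      obtain ⟨h1, h2, h3⟩ := hcon
      have : insert g A ≤ A := hA.2 (y := insert g A) (by
        rintro x (rfl | hx)
        · rintro (h | h)
          · exact hd (by simpa using h)
          · exact h2 h
        · rintro (h | h)
          · exact h3 (by rw [← h]; simpa using hx)
          · exact hAd x hx h) (subset_insert _ _)
      exact h1 (this (mem_insert _ _))
    have hstar : ∀ x ∈ starSet p A, d * x ∉ starSet p A := by
      intro x hx hdx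
      obtain ⟨y, hy1, hy2⟩ := p.nonempty_of_mem (inter_mem hx hdx)
      exact hAd _ hy1 (by simpa [mul_assoc] using hy2)
    have hs : s ∈ starSet p A ∨ d * s ∈ starSet p A ∨ d⁻¹ * s ∈ starSet p A := by
      have h0 : {h | s * h ∈ A} ∪ ({h | d * s * h ∈ A} ∪ {h | d⁻¹ * s * h ∈ A}) ∈ p := by
        refine Filter.mem_of_superset (f := (p : Filter G)) univ_mem (univ_subset_iff.2 ?_)
        rw [eq_univ_iff_forall]
        intro h
        have := hcov (s * h)
        simpa [mul_assoc] using this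
      rwa [Ultrafilter.union_mem_iff, Ultrafilter.union_mem_iff] at h0
    rcases hs with h | h | h
    · exact ⟨_, ⟨A, rfl⟩, h, hstar⟩
    · refine ⟨{x | d * x ∈ starSet p A}, ⟨{x | d * x ∈ A}, ?_⟩, h, ?_⟩
      · ext x; simp [starSet, mul_assoc]
      · exact fun x hx => hstar _ hx
    · refine ⟨{x | d⁻¹ * x ∈ starSet p A}, ⟨{x | d⁻¹ * x ∈ A}, ?_⟩, h, ?_⟩
      · ext x; simp [starSet, mul_assoc]
      · intro x hx hx'
        exact hstar _ hx (by simpa using hx')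


/-! ### Følner estimates -/

lemma folner_mul_card {G : Type} [Group G] [DecidableEq G] {F : ℕ → Finset G} (hF : IsFolner F)
    (K : Finset G) {δ : ℝ} (hδ : 0 < δ) :
    ∀ᶠ n in atTop, ((Finset.image₂ (fun k g => k * g) K (F n)).card : ℝ) ≤
      (1 + δ) * (F n).card := by
  have h := hF.2 (insert 1 (K.image (·⁻¹)))
  have h2 := h.eventually (gt_mem_nhds hδ)
  filter_upwards [h2] with n hn
  set L : Finset G := insert 1 (K.image (·⁻¹)) with hL
  set S : Set G := {g : G | (∃ k ∈ L, k * g ∈ F n) ∧ ∃ k ∈ L, k * g ∉ F n} with hS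
  have hpos : (0:ℝ) < (F n).card := by exact_mod_cast (hF.1 n).card_pos
  rw [div_lt_iff₀ hpos] at hn
  have hfin : S.Finite := by
    apply Set.Finite.subset (Finset.finite_toSet (Finset.image₂ (fun k g => k⁻¹ * g) L (F n)))
    rintro g ⟨⟨k, hk, hkg⟩, -⟩
    simp only [Finset.coe_image₂, Set.mem_image2]
    exact ⟨k, hk, k * g, hkg, by simp⟩
  have hsub : (Finset.image₂ (fun k g => k * g) K (F n)) ⊆ F n ∪ hfin.toFinset := by
    intro g hg
    rw [Finset.mem_image₂] at hg
    obtain ⟨k, hk, x, hx, rfl⟩ := hg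
    rw [Finset.mem_union, Set.Finite.mem_toFinset]
    by_cases hmem : k * x ∈ F n
    · exact Or.inl hmem
    · refine Or.inr ⟨⟨k⁻¹, ?_, by simpa using hx⟩, ⟨1, ?_, by simpa using hmem⟩⟩
      · rw [hL]; exact Finset.mem_insert_of_mem (Finset.mem_image_of_mem _ hk)
      · rw [hL]; exact Finset.mem_insert_self _ _
  have hc := (Finset.card_le_card hsub).trans (Finset.card_union_le _ _)
  have hc' : ((Finset.image₂ (fun k g => k * g) K (F n)).card : ℝ) ≤ (F n).card + S.ncard := by
    rw [Set.ncard_eq_toFinset_card S hfin]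
    exact_mod_cast hc
  linarith

open Classical in
lemma folner_sparse {G : Type} [Group G] {F : ℕ → Finset G} (hF : IsFolner F)
    (E : Finset G) (U : Set G) (hEU : ∀ e ∈ E, ∀ e' ∈ E, ∀ x ∈ U, ∀ y ∈ U, e * x = e' * y → e = e')
    (a : G) :
    ∀ᶠ n in atTop, (E.card : ℝ) * ((F n).filter (fun g => a * g ∈ U)).card ≤ 2 * (F n).card := by
  filter_upwards [folner_mul_card hF (E.image (fun e => a⁻¹ * e * a)) one_pos] with n hn
  refine le_trans ?_ (hn.trans (by norm_num))
  rw [← Nat.cast_mul, ← Finset.card_product]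
  norm_cast
  apply Finset.card_le_card_of_injOn (fun p => a⁻¹ * p.1 * a * p.2)
  · rintro ⟨e, g⟩ hp
    simp only [Finset.coe_product, Set.mem_prod, Finset.mem_coe, Finset.mem_filter] at hp
    simp only [Finset.mem_coe, Finset.mem_image₂]
    exact ⟨_, Finset.mem_image_of_mem _ hp.1, g, hp.2.1, rfl⟩
  · rintro ⟨e, g⟩ hp ⟨e', g'⟩ hp' heq
    simp only [Finset.coe_product, Set.mem_prod, Finset.mem_coe, Finset.mem_filter] at hp hp'
    have h1 : e * (a * g) = e' * (a * g') := by
      have : a⁻¹ * e * a * g = a⁻¹ * e' * a * g' := heq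
      rw [mul_assoc, mul_assoc, mul_assoc, mul_assoc] at this
      exact mul_left_cancel this
    have h2 := hEU e hp.1 e' hp'.1 _ hp.2.2 _ hp'.2.2 h1
    subst h2
    have h3 := mul_left_cancel (mul_left_cancel h1)
    rw [h3]

/-! ### The step of the construction -/

lemma SynAlg.empty_mem {G : Type} [Group G] {B : Set (Set G)} (hB : SynAlg B) : ∅ ∈ B := by
  have := hB.compl_mem _ hB.univ_mem
  rwa [compl_univ] at this

lemma SynAlg.union_mem {G : Type} [Group G] {B : Set (Set G)} (hB : SynAlg B) (S T : Set G)
    (hS : S ∈ B) (hT : T ∈ B) : S ∪ T ∈ B := by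
  have := hB.compl_mem _ (hB.inter_mem _ (hB.compl_mem _ hS) _ (hB.compl_mem _ hT))
  rwa [compl_inter, compl_compl, compl_compl] at this

lemma SynAlg.biInter_mem {G : Type} [Group G] {B : Set (Set G)} (hB : SynAlg B) {ι : Type}
    (I : Finset ι) (S : ι → Set G) (h : ∀ i ∈ I, S i ∈ B) : {g | ∀ i ∈ I, g ∈ S i} ∈ B := by
  classical
  induction I using Finset.induction_on with
  | empty =>
    convert hB.univ_mem
    ext; simp
  | insert a s ha ih =>
    have := hB.inter_mem _ (h a (Finset.mem_insert_self _ _)) _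
      (ih fun i hi => h i (Finset.mem_insert_of_mem hi))
    convert this using 1
    ext g; simp

lemma SynAlg.biUnion_mem {G : Type} [Group G] {B : Set (Set G)} (hB : SynAlg B) {ι : Type}
    (I : Finset ι) (S : ι → Set G) (h : ∀ i ∈ I, S i ∈ B) : {g | ∃ i ∈ I, g ∈ S i} ∈ B := by
  have := hB.compl_mem _ (hB.biInter_mem I (fun i => (S i)ᶜ) (fun i hi => hB.compl_mem _ (h i hi)))
  convert this using 1
  ext g; simp

lemma SynAlg.sep_finset {G : Type} [Group G] {B : Set (Set G)} (hB : SynAlg B) (D : Finset G)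
    (hD : 1 ∉ D) (s : G) : ∃ S ∈ B, s ∈ S ∧ ∀ d ∈ D, ∀ x ∈ S, d * x ∉ S := by
  have : ∀ d : D, ∃ S ∈ B, s ∈ S ∧ ∀ x ∈ S, d.1 * x ∉ S := fun d =>
    hB.sep d (fun h => hD (h ▸ d.2)) s
  choose S h1 h2 h3 using this
  refine ⟨{g | ∀ d ∈ Finset.univ, g ∈ S d}, hB.biInter_mem _ _ (fun d _ => h1 d),
    fun d _ => h2 d, fun d hd x hx hx' => ?_⟩
  exact h3 ⟨d, hd⟩ x (hx _ (Finset.mem_univ _)) (hx' _ (Finset.mem_univ _))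

/-- A stage of the construction: an interval at each group element. -/
structure Stage {G : Type} (B : Set (Set G)) (c : G → ℝ × ℝ) : Prop where
  lo : ∀ g, 0 ≤ (c g).1
  hi : ∀ g, (c g).2 ≤ 1
  width : ∃ η > 0, ∀ g, η ≤ (c g).2 - (c g).1
  level : ∀ v, {g | c g = v} ∈ B

/-- clipping an interval -/
noncomputable def clip (I : ℝ × ℝ) (q ε : ℝ) : ℝ × ℝ := (max I.1 (q - ε), min I.2 (q + ε))

open Classical in
lemma step {G : Type} [Group G] [Infinite G] {B : Set (Set G)} (hB : SynAlg B)
    {F : ℕ → Finset G} (hF : IsFolner F) {c : G → ℝ × ℝ} (hc : Stage B c)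
    (K : Finset G) (q : G → ℝ) {ε : ℝ} (hε : 0 < ε) (W : Finset G) {δ : ℝ} (hδ : 0 < δ) :
    ∃ (c' : G → ℝ × ℝ) (A : Set G), Stage B c' ∧ (∀ g ∈ W, g ∉ A) ∧ (∀ g, g ∉ A → c' g = c g) ∧
      (∀ g, (c g).1 ≤ (c' g).1 ∧ (c' g).2 ≤ (c g).2) ∧
      ((∀ k ∈ K, q k ∈ Icc (c k).1 (c k).2) → ∃ T : Finset G, ∀ h, ∃ t ∈ T, ∀ k ∈ K,
        q k - ε ≤ (c' (k * (t * h))).1 ∧ (c' (k * (t * h))).2 ≤ q k + ε) ∧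
      ∀ f, ∀ᶠ n in atTop, (((F n).filter (fun g => f * g ∈ A)).card : ℝ) ≤ δ * (F n).card := by
  by_cases hq : ∀ k ∈ K, q k ∈ Icc (c k).1 (c k).2
  swap
  · refine ⟨c, ∅, hc, by simp, fun _ _ => rfl, fun _ => ⟨le_rfl, le_rfl⟩,
      fun h => absurd h hq, fun f => Eventually.of_forall fun n => ?_⟩
    simp; positivity
  -- the recurrence set
  let R : Set G := {s | ∀ k ∈ K, s ∈ {s | c (k * s) = c k}}
  have hR : R ∈ B := hB.biInter_mem K _ (fun k _ => hB.trans_mem k _ (hc.level (c k)))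
  have hR1 : (1:G) ∈ R := fun k _ => by simp
  have hRinf : R.Infinite := by
    intro hfin
    obtain ⟨T, hT⟩ := hB.synd R hR ⟨1, hR1⟩
    apply (Set.infinite_univ (α := G))
    apply Set.Finite.subset (Set.Finite.image2 (fun t r => t⁻¹ * r) T.finite_toSet hfin)
    intro h _
    obtain ⟨t, ht, hth⟩ := hT h
    exact ⟨t, ht, t * h, hth, by simp⟩
  obtain ⟨s0, hs0R, hs0⟩ := hRinf.exists_notMem_finset (Finset.image₂ (fun k w => k⁻¹ * w) K W)
  -- the separating translates
  obtain ⟨E, hKE, hEc⟩ := Infinite.exists_superset_card_eq K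
    (K.card + (⌈2 * K.card / δ⌉₊ + 1)) (Nat.le_add_right _ _)
  have hE1 : 2 * K.card ≤ δ * E.card := by
    rw [hEc]
    have := Nat.le_ceil (2 * K.card / δ)
    rw [div_le_iff₀ hδ] at this
    push_cast
    have h0 : (0:ℝ) ≤ K.card := by positivity
    nlinarith
  have hEpos : (0:ℝ) < E.card := by rw [hEc]; positivity
  let D : Finset G := ((Finset.image₂ (fun e e' => e'⁻¹ * e) E E) ∪
    (Finset.image₂ (fun k w => k⁻¹ * w * s0⁻¹) K W)).erase 1
  obtain ⟨S, hSB, hs0S, hSD⟩ := hB.sep_finset D (Finset.notMem_erase _ _) s0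
  let U : Set G := R ∩ S
  have hU : U ∈ B := hB.inter_mem _ hR _ hSB
  have hs0U : s0 ∈ U := ⟨hs0R, hs0S⟩
  have hUE : ∀ e ∈ E, ∀ e' ∈ E, ∀ x ∈ U, ∀ y ∈ U, e * x = e' * y → e = e' := by
    intro e he e' he' x hx y hy h
    by_contra hne
    have hd : e'⁻¹ * e ∈ D := by
      refine Finset.mem_erase.2 ⟨fun h1 => hne ?_, Finset.mem_union_left _
        (Finset.mem_image₂_of_mem he he')⟩
      rw [inv_mul_eq_one] at h1
      exact h1.symm
    apply hSD _ hd x hx.2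
    rw [mul_assoc, h]
    simpa using hy.2
  have hUW : ∀ k ∈ K, ∀ w ∈ W, k⁻¹ * w ∉ U := by
    intro k hk w hw hmem
    have hne : k⁻¹ * w ≠ s0 := fun h => hs0 (h ▸ Finset.mem_image₂_of_mem hk hw)
    have hd : k⁻¹ * w * s0⁻¹ ∈ D := by
      refine Finset.mem_erase.2 ⟨fun h1 => hne ?_, Finset.mem_union_right _
        (Finset.mem_image₂_of_mem hk hw)⟩
      rwa [mul_inv_eq_one] at h1
    apply hSD _ hd s0 hs0S
    simpa using hmem.2
  let A : Set G := {g | ∃ k ∈ K, g ∈ {g | k⁻¹ * g ∈ U}}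
  have hA : A ∈ B := hB.biUnion_mem K _ (fun k _ => hB.trans_mem _ _ hU)
  let c' : G → ℝ × ℝ := fun g => if h : g ∈ A then clip (c g) (q h.choose) ε else c g
  have hc'1 : ∀ g, g ∉ A → c' g = c g := fun g hg => dif_neg hg
  have hc'2 : ∀ k ∈ K, ∀ x ∈ U, c' (k * x) = clip (c k) (q k) ε := by
    intro k hk x hx
    have hm : k * x ∈ A := ⟨k, hk, by simpa using hx⟩
    have h1 : c' (k * x) = clip (c (k * x)) (q hm.choose) ε := dif_pos hm
    have h2 := hm.choose_spec
    have h3 : hm.choose = k := by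
      refine hUE _ (hKE h2.1) _ (hKE hk) _ h2.2 _ hx ?_
      simp
    rw [h1, h3, hx.1 k hk]
  have hAform : ∀ g ∈ A, ∃ k ∈ K, ∃ x ∈ U, g = k * x := by
    rintro g ⟨k, hk, hg⟩
    exact ⟨k, hk, _, hg, by simp⟩
  refine ⟨c', A, ⟨?_, ?_, ?_, ?_⟩, ?_, hc'1, ?_, ?_, ?_⟩
  · intro g
    by_cases hg : g ∈ A
    · obtain ⟨k, hk, x, hx, rfl⟩ := hAform g hg
      rw [hc'2 k hk x hx]
      exact (hc.lo k).trans (le_max_left _ _)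
    · rw [hc'1 g hg]; exact hc.lo g
  · intro g
    by_cases hg : g ∈ A
    · obtain ⟨k, hk, x, hx, rfl⟩ := hAform g hg
      rw [hc'2 k hk x hx]
      exact (min_le_left _ _).trans (hc.hi k)
    · rw [hc'1 g hg]; exact hc.hi g
  · obtain ⟨η, hη, hw⟩ := hc.width
    refine ⟨min η ε, lt_min hη hε, fun g => ?_⟩
    by_cases hg : g ∈ A
    · obtain ⟨k, hk, x, hx, rfl⟩ := hAform g hg
      rw [hc'2 k hk x hx]
      have h1 := (hq k hk).1
      have h2 := (hq k hk).2
      have h3 := hw k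
      have h4 := min_le_left η ε
      have h5 := min_le_right η ε
      simp only [clip]
      rcases max_cases (c k).1 (q k - ε) with h | h <;>
      rcases min_cases (c k).2 (q k + ε) with h' | h' <;>
      rw [h.1, h'.1] <;> linarith
    · rw [hc'1 g hg]; exact (min_le_left _ _).trans (hw g)
  · intro v
    have h1 : {g | ∃ k ∈ K.filter (fun k => clip (c k) (q k) ε = v), g ∈ {g | k⁻¹ * g ∈ U}} ∈ B :=
      hB.biUnion_mem _ _ (fun k _ => hB.trans_mem _ _ hU)
    have h2 := hB.union_mem _ _ (hB.inter_mem _ (hc.level v) _ (hB.compl_mem _ hA)) h1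
    convert h2 using 1
    ext g
    simp only [mem_union, mem_inter_iff, mem_compl_iff, Set.mem_ofPred_eq, Finset.mem_filter]
    constructor
    · intro h
      by_cases hg : g ∈ A
      · right
        obtain ⟨k, hk, x, hx, rfl⟩ := hAform g hg
        rw [hc'2 k hk x hx] at h
        exact ⟨k, ⟨hk, h⟩, by simpa using hx⟩
      · left
        rw [hc'1 g hg] at h
        exact ⟨h, hg⟩
    · rintro (⟨h, hg⟩ | ⟨k, ⟨hk, h⟩, hg⟩)
      · rw [hc'1 g hg, h]
      · have := hc'2 k hk _ hg
        rw [← h, ← this]; simp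
  · rintro g hg ⟨k, hk, h⟩
    exact hUW k hk g hg h
  · intro g
    by_cases hg : g ∈ A
    · obtain ⟨k, hk, x, hx, rfl⟩ := hAform g hg
      rw [hc'2 k hk x hx, hx.1 k hk]
      exact ⟨le_max_left _ _, min_le_left _ _⟩
    · rw [hc'1 g hg]; exact ⟨le_rfl, le_rfl⟩
  · intro _
    obtain ⟨T, hT⟩ := hB.synd U hU ⟨s0, hs0U⟩
    refine ⟨T, fun h => ?_⟩
    obtain ⟨t, ht, hth⟩ := hT h
    refine ⟨t, ht, fun k hk => ?_⟩
    rw [hc'2 k hk _ hth]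
    exact ⟨le_max_right _ _, min_le_right _ _⟩
  · intro f
    have hev : ∀ᶠ n in atTop, ∀ k ∈ K,
        (E.card : ℝ) * ((F n).filter (fun g => k⁻¹ * f * g ∈ U)).card ≤ 2 * (F n).card := by
      rw [Filter.eventually_all_finset]
      intro k _
      convert folner_sparse hF E U hUE (k⁻¹ * f)
    filter_upwards [hev] with n hn
    have hsub : (F n).filter (fun g => f * g ∈ A) ⊆
        K.biUnion (fun k => (F n).filter (fun g => k⁻¹ * f * g ∈ U)) := by
      intro g hg
      rw [Finset.mem_filter] at hg
      obtain ⟨hg1, k, hk, hg2⟩ := hg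
      rw [Finset.mem_biUnion]
      refine ⟨k, hk, Finset.mem_filter.2 ⟨hg1, ?_⟩⟩
      rw [mul_assoc]; exact hg2
    have h1 : (((F n).filter (fun g => f * g ∈ A)).card : ℝ) ≤
        ∑ k ∈ K, (((F n).filter (fun g => k⁻¹ * f * g ∈ U)).card : ℝ) := by
      exact_mod_cast (Finset.card_le_card hsub).trans Finset.card_biUnion_le
    have h2 : (E.card : ℝ) * ∑ k ∈ K, (((F n).filter (fun g => k⁻¹ * f * g ∈ U)).card : ℝ) ≤
        K.card * (2 * (F n).card) := by
      rw [Finset.mul_sum]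
      have := Finset.sum_le_sum hn
      simpa using this
    have h3 : (0:ℝ) ≤ (F n).card := by positivity
    have h4 : (E.card : ℝ) * (((F n).filter (fun g => f * g ∈ A)).card : ℝ) ≤
        E.card * (δ * (F n).card) := by
      refine (mul_le_mul_of_nonneg_left h1 hEpos.le).trans (h2.trans ?_)
      nlinarith
    have h5 := le_of_mul_le_mul_left h4 hEpos
    refine le_trans (le_of_eq ?_) h5
    congr!


/-! ### The recursive construction -/

/-- invariants of a state `(c, w, W)` -/
def StInv {G : Type} [Group G] (B : Set (Set G)) (F : ℕ → Finset G)
    (σ : (G → ℝ × ℝ) × (G → ℝ) × Finset G) : Prop :=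
  Stage B σ.1 ∧ (∀ g, 0 ≤ σ.2.1 g) ∧
    ∃ θ : ℝ, θ < 1 ∧ ∀ f, ∀ᶠ n in atTop, ∑ g ∈ F n, σ.2.1 (f * g) ≤ θ * (F n).card

/-- the relation between consecutive states -/
def StRel {G : Type} [Group G] (n : ℕ) (Φ K : Finset G) (q : G → ℝ) (ε : ℝ)
    (σ σ' : (G → ℝ × ℝ) × (G → ℝ) × Finset G) : Prop :=
  σ.2.2 ⊆ σ'.2.2 ∧ Φ ⊆ σ'.2.2 ∧ (∀ g ∈ σ'.2.2, σ'.1 g = σ.1 g ∧ σ'.2.1 g = σ.2.1 g) ∧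
  (∀ g, (σ.1 g).1 ≤ (σ'.1 g).1 ∧ (σ'.1 g).2 ≤ (σ.1 g).2) ∧
  (∀ g, σ.2.1 g ≤ σ'.2.1 g) ∧ (∀ g, σ'.1 g = σ.1 g ∨ (2:ℝ) ^ n ≤ σ'.2.1 g) ∧
  (∃ h, (∀ f ∈ Φ, f * h ∈ σ'.2.2) ∧ ∑ f ∈ Φ, σ.2.1 (f * h) ≤ Φ.card) ∧
  (0 < ε → (∀ k ∈ K, q k ∈ Icc (σ.1 k).1 (σ.1 k).2) → ∃ T : Finset G, ∀ h, ∃ t ∈ T, ∀ k ∈ K,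
        q k - ε ≤ (σ'.1 (k * (t * h))).1 ∧ (σ'.1 (k * (t * h))).2 ≤ q k + ε)

lemma st_step {G : Type} [Group G] [Infinite G] {B : Set (Set G)} (hB : SynAlg B)
    {F : ℕ → Finset G} (hF : IsFolner F) (n : ℕ) (Φ K : Finset G) (q : G → ℝ) (ε : ℝ)
    (σ : (G → ℝ × ℝ) × (G → ℝ) × Finset G) (hσ : StInv B F σ) :
    ∃ σ', StInv B F σ' ∧ StRel n Φ K q ε σ σ' := by
  classical
  obtain ⟨c, w, W⟩ := σ
  obtain ⟨hc, hw0, θ, hθ, hwθ⟩ := hσ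
  simp only at hc hw0 hwθ
  -- averaging
  obtain ⟨h, hh⟩ : ∃ h, ∑ f ∈ Φ, w (f * h) ≤ Φ.card := by
    have hev : ∀ᶠ n in atTop, ∀ f ∈ Φ, ∑ g ∈ F n, w (f * g) ≤ θ * (F n).card := by
      rw [Filter.eventually_all_finset]
      exact fun f _ => hwθ f
    obtain ⟨N, hN⟩ := hev.exists
    have hsum : ∑ g ∈ F N, ∑ f ∈ Φ, w (f * g) ≤ ∑ g ∈ F N, (Φ.card : ℝ) := by
      rw [Finset.sum_comm]
      refine (Finset.sum_le_sum hN).trans ?_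
      simp only [Finset.sum_const, nsmul_eq_mul]
      have h1 : (0:ℝ) ≤ (F N).card := by positivity
      have h2 : (0:ℝ) ≤ Φ.card := by positivity
      have h3 : (0:ℝ) ≤ (Φ.card:ℝ) * (F N).card := by positivity
      nlinarith
    obtain ⟨h, _, hh⟩ := Finset.exists_le_of_sum_le (hF.1 N) hsum
    exact ⟨h, hh⟩
  set W' : Finset G := W ∪ (Φ ∪ Φ.image (· * h)) with hW'
  set ε' : ℝ := if 0 < ε then ε else 1 with hε'
  have hε'0 : 0 < ε' := by rw [hε']; split_ifs <;> linarith
  have h2n : (0:ℝ) < 2 ^ n := by positivity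
  set δ : ℝ := (1 - θ) / 2 / 2 ^ n with hδ
  have hδ0 : 0 < δ := by
    have : 0 < 1 - θ := by linarith
    positivity
  obtain ⟨c', A, h1, h2, h3, h4, h5, h6⟩ := step hB hF hc K q hε'0 W' hδ0
  refine ⟨(c', fun g => w g + if g ∈ A then 2 ^ n else 0, W'), ⟨h1, ?_, ?_⟩, ?_⟩
  · intro g
    have := hw0 g
    simp only
    split_ifs <;> positivity
  · refine ⟨(1 + θ) / 2, by linarith, fun f => ?_⟩
    filter_upwards [hwθ f, h6 f] with N hN1 hN2
    rw [Finset.sum_add_distrib, ← Finset.sum_filter, Finset.sum_const, nsmul_eq_mul]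
    have h7 : δ * 2 ^ n = (1 - θ) / 2 := by rw [hδ]; field_simp
    have h8 : (((F N).filter (fun g => f * g ∈ A)).card : ℝ) * 2 ^ n ≤
      δ * (F N).card * 2 ^ n := mul_le_mul_of_nonneg_right (by convert hN2) h2n.le
    have h9 : δ * (F N).card * 2 ^ n = (1 - θ) / 2 * (F N).card := by rw [← h7]; ring
    rw [h9] at h8
    have := add_le_add hN1 h8
    refine this.trans (le_of_eq ?_)
    ring
  · refine ⟨Finset.subset_union_left, ?_, ?_, h4, ?_, ?_, ⟨h, ?_, hh⟩, ?_⟩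
    · exact fun g hg => Finset.mem_union_right _ (Finset.mem_union_left _ hg)
    · intro g hg
      refine ⟨h3 g (h2 g hg), ?_⟩
      simp [h2 g hg]
    · intro g
      simp only
      split_ifs <;> linarith
    · intro g
      by_cases hg : g ∈ A
      · right
        simp only [hg, if_true]
        have := hw0 g
        linarith
      · exact Or.inl (h3 g hg)
    · exact fun f hf => Finset.mem_union_right _ (Finset.mem_union_right _
        (Finset.mem_image_of_mem _ hf))
    · intro hε hq
      have : ε' = ε := by rw [hε', if_pos hε]
      rw [this] at h5
      exact h5 hq

lemma exists_intervals {G : Type} [Group G] [Countable G] [Infinite G]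
    (hAmen : ∃ F : ℕ → Finset G, IsFolner F) :
    ∃ I : G → ℝ × ℝ, (∀ g, 0 ≤ (I g).1 ∧ (I g).1 < (I g).2 ∧ (I g).2 ≤ 1) ∧
      (∀ n : ℕ, ∃ η > 0, ∀ Φ : Finset G, ∃ h,
        (2:ℝ) ^ n * (Φ.filter (fun f => (I (f * h)).2 - (I (f * h)).1 < η)).card ≤ Φ.card) ∧
      (∀ (K : Finset G) (q : G → ℚ) (ε : ℚ), 0 < ε →
        (∀ k ∈ K, (q k : ℝ) ∈ Icc (I k).1 (I k).2) → ∃ T : Finset G, ∀ h, ∃ t ∈ T, ∀ k ∈ K,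
        (q k - ε : ℝ) ≤ (I (k * (t * h))).1 ∧ (I (k * (t * h))).2 ≤ q k + ε) := by
  classical
  obtain ⟨F, hF⟩ := hAmen
  obtain ⟨B, hB⟩ := exists_synAlg G
  obtain ⟨r, hr⟩ := exists_surjective_nat (Finset G × (G →₀ ℚ) × ℚ)
  obtain ⟨Φ, hΦ⟩ := exists_surjective_nat (Finset G)
  have hst : ∀ n σ, StInv B F σ → ∃ σ', StInv B F σ' ∧
      StRel n (Φ n) (r n).1 (fun g => ((r n).2.1 g : ℝ)) ((r n).2.2 : ℝ) σ σ' :=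
    fun n σ hσ => st_step hB hF n _ _ _ _ σ hσ
  have hinit : StInv B F ((fun _ => (0, 1), fun _ => 0, ∅)) := by
    refine ⟨⟨fun _ => le_rfl, fun _ => le_rfl, ⟨1, one_pos, fun g => by simp⟩, fun v => ?_⟩,
      fun _ => le_rfl, 0, one_pos, fun f => by simp⟩
    by_cases hv : ((0:ℝ), (1:ℝ)) = v
    · convert hB.univ_mem; simp [hv]
    · convert hB.empty_mem; simp [hv]
  let s : ℕ → {σ // StInv B F σ} := fun n => Nat.rec ⟨_, hinit⟩
    (fun n σ => ⟨(hst n σ.1 σ.2).choose, (hst n σ.1 σ.2).choose_spec.1⟩) n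
  have hs : ∀ n, StRel n (Φ n) (r n).1 (fun g => ((r n).2.1 g : ℝ)) ((r n).2.2 : ℝ)
      (s n).1 (s (n+1)).1 := fun n => (hst n (s n).1 (s n).2).choose_spec.2
  let c : ℕ → G → ℝ × ℝ := fun n => (s n).1.1
  let w : ℕ → G → ℝ := fun n => (s n).1.2.1
  let W : ℕ → Finset G := fun n => (s n).1.2.2
  have hW : Monotone W := monotone_nat_of_le_succ fun n => (hs n).1
  have hstab : ∀ m g, g ∈ W (m + 1) → ∀ n, m ≤ n → c n g = c m g ∧ w n g = w m g := by
    intro m g hg n hmn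
    induction n, hmn using Nat.le_induction with
    | base => exact ⟨rfl, rfl⟩
    | succ n hmn ih =>
      have := (hs n).2.2.1 g (hW (show m + 1 ≤ n + 1 by omega) hg)
      exact ⟨this.1.trans ih.1, this.2.trans ih.2⟩
  have hex : ∀ g, ∃ m, g ∈ W (m + 1) := by
    intro g
    obtain ⟨m, hm⟩ := hΦ {g}
    exact ⟨m, (hs m).2.1 (by rw [hm]; simp)⟩
  choose M hM using hex
  let I : G → ℝ × ℝ := fun g => c (M g) g
  let v : G → ℝ := fun g => w (M g) g
  have hI : ∀ m g, g ∈ W (m + 1) → I g = c m g ∧ v g = w m g := by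
    intro m g hg
    have h1 := hstab m g hg (max m (M g)) (le_max_left _ _)
    have h2 := hstab (M g) g (hM g) (max m (M g)) (le_max_right _ _)
    exact ⟨h2.1.symm.trans h1.1, h2.2.symm.trans h1.2⟩
  have hI' : ∀ g n, M g ≤ n → I g = c n g ∧ v g = w n g := fun g n hn =>
    ⟨(hstab (M g) g (hM g) n hn).1.symm, (hstab (M g) g (hM g) n hn).2.symm⟩
  have hnest : ∀ n m g, n ≤ m → (c n g).1 ≤ (c m g).1 ∧ (c m g).2 ≤ (c n g).2 := by
    intro n m g hnm
    induction m, hnm using Nat.le_induction with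
    | base => exact ⟨le_rfl, le_rfl⟩
    | succ m hnm ih =>
      have := (hs m).2.2.2.1 g
      exact ⟨ih.1.trans this.1, this.2.trans ih.2⟩
  have hwmono : ∀ n m g, n ≤ m → w n g ≤ w m g := by
    intro n m g hnm
    induction m, hnm using Nat.le_induction with
    | base => exact le_rfl
    | succ m hnm ih => exact ih.trans ((hs m).2.2.2.2.1 g)
  have hInest : ∀ n g, (c n g).1 ≤ (I g).1 ∧ (I g).2 ≤ (c n g).2 := by
    intro n g
    have h1 := hI' g (max n (M g)) (le_max_right _ _)
    rw [h1.1]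
    exact hnest _ _ _ (le_max_left _ _)
  have hconst : ∀ n g, v g < 2 ^ n → I g = c n g := by
    intro n g hv
    have key : ∀ m, n ≤ m → c m g = c n g := by
      intro m hnm
      induction m, hnm using Nat.le_induction with
      | base => rfl
      | succ m hnm ih =>
        rcases (hs m).2.2.2.2.2.1 g with h | h
        · exact h.trans ih
        · exfalso
          have h1 := hI' g (max (m+1) (M g)) (le_max_right _ _)
          have h2 := hwmono (m+1) (max (m+1) (M g)) g (le_max_left _ _)
          have h3 : (2:ℝ) ^ n ≤ 2 ^ m := pow_le_pow_right₀ (by norm_num) hnm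
          have h4 : (2:ℝ)^m ≤ w (m+1) g := h
          rw [← h1.2] at h2
          linarith
    rw [(hI' g (max n (M g)) (le_max_right _ _)).1]
    exact key _ (le_max_left _ _)
  have hv0 : ∀ g, 0 ≤ v g := fun g => (s (M g)).2.2.1 g
  refine ⟨I, ?_, ?_, ?_⟩
  · intro g
    have h := (s (M g)).2.1
    obtain ⟨η, hη, hw⟩ := h.width
    have := hw g
    refine ⟨h.lo g, ?_, h.hi g⟩
    show ((s (M g)).1.1 g).1 < ((s (M g)).1.1 g).2
    linarith
  · intro n
    obtain ⟨η, hη, hwid⟩ := (s n).2.1.width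
    refine ⟨η, hη, fun Ψ => ?_⟩
    obtain ⟨m, rfl⟩ := hΦ Ψ
    obtain ⟨h, hh1, hh2⟩ := (hs m).2.2.2.2.2.2.1
    refine ⟨h, le_trans ?_ hh2⟩
    have h1 : ∀ f ∈ Φ m, (s m).1.2.1 (f * h) = v (f * h) := fun f hf =>
      ((hI m _ (hh1 f hf)).2).symm
    rw [Finset.sum_congr rfl h1, mul_comm, ← nsmul_eq_mul, ← Finset.sum_const]
    refine le_trans (Finset.sum_le_sum ?_) (Finset.sum_le_sum_of_subset_of_nonneg
      (Finset.filter_subset _ _) (fun g _ _ => hv0 _))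
    intro f hf
    by_contra hlt
    have h2 := hconst n (f * h) (not_le.1 hlt)
    have h3 := (Finset.mem_filter.1 hf).2
    rw [h2] at h3
    exact absurd (hwid (f * h)) (not_le.2 h3)
  · intro K q ε hε hq
    obtain ⟨n, hn⟩ := hr (K, Finsupp.onFinset K (fun g => if g ∈ K then q g else 0) (by
      intro a ha; by_contra h; simp [h] at ha), ε)
    have h := (hs n).2.2.2.2.2.2.2
    rw [hn] at h
    simp only [Finsupp.onFinset_apply] at h
    obtain ⟨T, hT⟩ := h (by exact_mod_cast hε) (by
      intro k hk
      simp only [hk, if_true]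
      have := hInest n k
      exact ⟨this.1.trans (hq k hk).1, (hq k hk).2.trans this.2⟩)
    refine ⟨T, fun g => ?_⟩
    obtain ⟨t, ht, htk⟩ := hT g
    refine ⟨t, ht, fun k hk => ?_⟩
    have h1 := htk k hk
    simp only [hk, if_true] at h1
    have h2 := hInest (n+1) (k * (t * g))
    exact ⟨h1.1.trans h2.1, h2.2.trans h1.2⟩


/-! ### The subshift, its minimality and its mean dimension -/

/-- the product of the intervals -/
def boxSet {G : Type} (I : G → ℝ × ℝ) : Set (G → unitInterval) :=
  {x | ∀ g, (I g).1 ≤ (x g : ℝ) ∧ (x g : ℝ) ≤ (I g).2}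

/-- the subshift generated by the box -/
def boxShift {G : Type} [Group G] (I : G → ℝ × ℝ) : Set (G → unitInterval) :=
  closure (⋃ g : G, shift g '' boxSet I)

lemma shift_shift {G P : Type} [Group G] (a b : G) (x : G → P) :
    shift a (shift b x) = shift (a * b) x := by
  funext g; simp [shift, mul_assoc]

lemma continuous_shift {G P : Type} [Group G] [TopologicalSpace P] (a : G) :
    Continuous (shift a : (G → P) → (G → P)) :=
  continuous_pi fun g => continuous_apply (g * a)

lemma boxShift_shift {G : Type} [Group G] (I : G → ℝ × ℝ) (g : G) (x : G → unitInterval)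
    (hx : x ∈ boxShift I) : shift g x ∈ boxShift I := by
  refine map_mem_closure (continuous_shift g) hx ?_
  intro y hy
  rw [mem_iUnion] at hy
  obtain ⟨h, z, hz, rfl⟩ := hy
  rw [shift_shift]
  exact mem_iUnion.2 ⟨g * h, z, hz, rfl⟩

lemma mem_boxShift {G : Type} [Group G] (I : G → ℝ × ℝ) (g : G) (x : G → unitInterval)
    (hx : x ∈ boxSet I) : shift g x ∈ boxShift I :=
  subset_closure (mem_iUnion.2 ⟨g, x, hx, rfl⟩)

lemma box_recur {G : Type} [Group G] {I : G → ℝ × ℝ}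
    (hI : ∀ g, 0 ≤ (I g).1 ∧ (I g).1 < (I g).2 ∧ (I g).2 ≤ 1)
    (hR : ∀ (K : Finset G) (q : G → ℚ) (ε : ℚ), 0 < ε →
        (∀ k ∈ K, (q k : ℝ) ∈ Icc (I k).1 (I k).2) → ∃ T : Finset G, ∀ h, ∃ t ∈ T, ∀ k ∈ K,
        (q k - ε : ℝ) ≤ (I (k * (t * h))).1 ∧ (I (k * (t * h))).2 ≤ q k + ε)
    {y : G → unitInterval} (hy : y ∈ boxSet I) (K : Finset G) {ε : ℝ} (hε : 0 < ε)
    {z : G → unitInterval} (hz : z ∈ boxShift I) :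
    ∃ t : G, ∀ k ∈ K, |(z (k * t) : ℝ) - y k| ≤ ε := by
  have hq : ∀ g, ∃ q : ℚ, max (I g).1 (y g - ε / 4) < (q : ℝ) ∧
      (q : ℝ) < min (I g).2 (y g + ε / 4) := by
    intro g
    apply exists_rat_btwn
    have h1 := hy g
    have h2 := hI g
    rw [max_lt_iff, lt_min_iff, lt_min_iff]
    refine ⟨⟨?_, ?_⟩, ?_, ?_⟩ <;> linarith
  choose q hq using hq
  obtain ⟨e, he0, he1⟩ := exists_rat_btwn (show (0:ℝ) < ε / 2 by positivity)
  obtain ⟨T, hT⟩ := hR K q e (by exact_mod_cast he0) (fun k _ =>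
    ⟨((le_max_left _ _).trans (hq k).1.le), ((hq k).2.le.trans (min_le_left _ _))⟩)
  let S : Set (G → unitInterval) := ⋃ t ∈ T, ⋂ k ∈ K, {z | |(z (k * t) : ℝ) - y k| ≤ ε}
  have hS : IsClosed S := by
    refine Set.Finite.isClosed_biUnion T.finite_toSet (fun t _ => ?_)
    refine isClosed_biInter fun k _ => isClosed_le (by fun_prop) (by fun_prop)
  have hsub : boxShift I ⊆ S := by
    refine closure_minimal ?_ hS
    intro x hx
    rw [mem_iUnion] at hx
    obtain ⟨h, x, hx, rfl⟩ := hx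
    obtain ⟨t, ht, htk⟩ := hT h
    simp only [S, mem_iUnion, mem_iInter]
    refine ⟨t, ht, fun k hk => ?_⟩
    have h1 := htk k hk
    have h2 := hx (k * (t * h))
    have h3 := (le_max_right _ _).trans_lt (hq k).1
    have h4 := (hq k).2.trans_le (min_le_right _ _)
    simp only [Set.mem_ofPred_eq, shift, mul_assoc]
    rw [abs_le]
    constructor <;> linarith
  have := hsub hz
  simp only [S, mem_iUnion, mem_iInter] at this
  obtain ⟨t, _, ht⟩ := this
  exact ⟨t, ht⟩

lemma box_minimal {G : Type} [Group G] {I : G → ℝ × ℝ}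
    (hI : ∀ g, 0 ≤ (I g).1 ∧ (I g).1 < (I g).2 ∧ (I g).2 ≤ 1)
    (hR : ∀ (K : Finset G) (q : G → ℚ) (ε : ℚ), 0 < ε →
        (∀ k ∈ K, (q k : ℝ) ∈ Icc (I k).1 (I k).2) → ∃ T : Finset G, ∀ h, ∃ t ∈ T, ∀ k ∈ K,
        (q k - ε : ℝ) ≤ (I (k * (t * h))).1 ∧ (I (k * (t * h))).2 ≤ q k + ε)
    {z : G → unitInterval} (hz : z ∈ boxShift I) :
    closure (Set.range fun g : G => shift g z) = boxShift I := by
  apply subset_antisymm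
  · apply closure_minimal _ isClosed_closure
    rintro _ ⟨g, rfl⟩
    exact boxShift_shift I g z hz
  · have hinv : ∀ g x, x ∈ closure (Set.range fun g : G => shift g z) →
        shift g x ∈ closure (Set.range fun g : G => shift g z) := by
      intro g x hx
      refine map_mem_closure (continuous_shift g) hx ?_
      rintro _ ⟨h, rfl⟩
      exact ⟨g * h, (shift_shift _ _ _).symm⟩
    apply closure_minimal _ isClosed_closure
    intro x hx
    rw [mem_iUnion] at hx
    obtain ⟨g, y, hy, rfl⟩ := hx
    apply hinv
    rw [mem_closure_iff]
    intro O hO hyO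
    obtain ⟨K, u, hu, hKu⟩ := isOpen_pi_iff.1 hO y hyO
    have hev : ∀ᶠ ε in 𝓝[>] (0:ℝ), ∀ k ∈ K, Metric.closedBall (y k) ε ⊆ u k := by
      rw [Filter.eventually_all_finset]
      intro k hk
      obtain ⟨e, he, hb⟩ := Metric.isOpen_iff.1 (hu k hk).1 (y k) (hu k hk).2
      filter_upwards [Ioo_mem_nhdsGT he] with ε hε
      exact (Metric.closedBall_subset_ball hε.2).trans hb
    obtain ⟨ε, hε, hε0⟩ := (hev.and self_mem_nhdsWithin).exists
    obtain ⟨t, ht⟩ := box_recur hI hR hy K (show 0 < ε from hε0) hz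
    refine ⟨shift t z, hKu ?_, ⟨t, rfl⟩⟩
    intro k hk
    apply hε k hk
    rw [Metric.mem_closedBall, Subtype.dist_eq, Real.dist_eq]
    exact ht k hk

open Classical in
/-- the embedded cubes -/
noncomputable def cubeMap {G : Type} [Group G] (I : G → ℝ × ℝ)
    (hI : ∀ g, 0 ≤ (I g).1 ∧ (I g).1 < (I g).2 ∧ (I g).2 ≤ 1) (J : Finset G) (h : G)
    (u : J → unitInterval) : G → unitInterval := fun g =>
  ⟨(I g).1 + (if hm : g * h⁻¹ ∈ J then (u ⟨_, hm⟩ : ℝ) else 0) * ((I g).2 - (I g).1), by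
    have h1 := hI g
    split_ifs with hm
    · have h2 := (u ⟨_, hm⟩).2
      constructor
      · nlinarith [h2.1, h2.2]
      · nlinarith [h2.1, h2.2]
    · constructor <;> linarith⟩

lemma cubeMap_continuous {G : Type} [Group G] (I : G → ℝ × ℝ)
    (hI : ∀ g, 0 ≤ (I g).1 ∧ (I g).1 < (I g).2 ∧ (I g).2 ≤ 1) (J : Finset G) (h : G) :
    Continuous (cubeMap I hI J h) := by
  refine continuous_pi fun g => Continuous.subtype_mk ?_ _
  by_cases hm : g * h⁻¹ ∈ J
  · simp only [hm, dif_pos]; fun_prop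
  · simp only [hm, dif_neg, not_false_eq_true]; fun_prop

lemma cubeMap_mem {G : Type} [Group G] (I : G → ℝ × ℝ)
    (hI : ∀ g, 0 ≤ (I g).1 ∧ (I g).1 < (I g).2 ∧ (I g).2 ≤ 1) (J : Finset G) (h : G)
    (u : J → unitInterval) : cubeMap I hI J h u ∈ boxSet I := by
  intro g
  have h1 := hI g
  simp only [cubeMap]
  split_ifs with hm
  · have h2 := (u ⟨_, hm⟩).2
    constructor
    · nlinarith [h2.1, h2.2]
    · nlinarith [h2.1, h2.2]
  · constructor <;> linarith

lemma cubeMap_apply {G : Type} [Group G] (I : G → ℝ × ℝ)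
    (hI : ∀ g, 0 ≤ (I g).1 ∧ (I g).1 < (I g).2 ∧ (I g).2 ≤ 1) (J : Finset G) (h : G)
    (u : J → unitInterval) (j : J) :
    (cubeMap I hI J h u (j.1 * h) : ℝ) =
      (I (j.1 * h)).1 + u j * ((I (j.1 * h)).2 - (I (j.1 * h)).1) := by
  have : j.1 * h * h⁻¹ = j.1 := by simp
  simp only [cubeMap]
  rw [dif_pos (by rw [this]; exact j.2)]
  congr 4
  exact Subtype.ext this

lemma mdim_lower {G : Type} [Group G] {I : G → ℝ × ℝ}
    (hI : ∀ g, 0 ≤ (I g).1 ∧ (I g).1 < (I g).2 ∧ (I g).2 ≤ 1)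
    (hw : ∀ n : ℕ, ∃ η > 0, ∀ Φ : Finset G, ∃ h,
        (2:ℝ) ^ n * (Φ.filter (fun f => (I (f * h)).2 - (I (f * h)).1 < η)).card ≤ Φ.card)
    {ρ : (G → unitInterval) → (G → unitInterval) → ℝ} (hρ : IsCompatMetric ρ)
    (F : ℕ → Finset G) (hF : IsFolner F) : 1 ≤ mdimWith (boxShift I) ρ F hF.1 := by
  classical
  have key : ∀ n : ℕ, 1 - (2⁻¹ : ENNReal) ^ n ≤ mdimWith (boxShift I) ρ F hF.1 := by
    intro n
    obtain ⟨η, hη, hΦ⟩ := hw n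
    obtain ⟨ε, hε, hsep⟩ := compat_sep hρ 1 hη
    refine le_trans ?_ (le_iSup₂ (f := fun (ε : ℝ) (_ : 0 < ε) => Filter.atTop.limsup fun n =>
      dimEps (boxShift I) (fun x y => (F n).sup' (hF.1 n) fun g => ρ (shift g x.1) (shift g y.1)) ε
      / ((F n).card : ENNReal)) ε hε)
    refine Filter.le_limsup_of_frequently_le (Eventually.frequently
      (Eventually.of_forall fun N => ?_))
    have hpos := (hF.1 N).card_pos
    rw [ENNReal.le_div_iff_mul_le (Or.inl (by exact_mod_cast hpos.ne'))
      (Or.inl (ENNReal.natCast_ne_top _))]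
    refine le_sInf ?_
    rintro _ ⟨P, _, f, hP, hf, hinj, rfl⟩
    refine le_sInf ?_
    rintro _ ⟨m, rfl, hm⟩
    obtain ⟨h, hh⟩ := hΦ (F N)
    set J : Finset G := (F N).filter (fun f => ¬ (I (f * h)).2 - (I (f * h)).1 < η) with hJ
    have hcard : J.card ≤ m := by
      have := embed_dim (J := J) (P := P)
        (fun u => f ⟨shift h (cubeMap I hI J h u), mem_boxShift I h _ (cubeMap_mem I hI J h u)⟩)
        (hf.comp (Continuous.subtype_mk ((continuous_shift h).comp (cubeMap_continuous I hI J h)) _))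
        (by
          intro u v huv j hu hv
          have h1 := hinj _ _ huv
          have hjF : j.1 ∈ F N := (Finset.mem_filter.1 j.2).1
          have h2 := (Finset.le_sup' (fun g => ρ (shift g (shift h (cubeMap I hI J h u)))
            (shift g (shift h (cubeMap I hI J h v)))) hjF).trans h1
          have h3 := hsep _ _ h2
          simp only [shift, one_mul] at h3
          rw [cubeMap_apply, cubeMap_apply, hu, hv] at h3
          have h4 := (Finset.mem_filter.1 j.2).2
          apply h4
          have h5 := neg_abs_le ((I (j.1 * h)).1 + ((0:unitInterval):ℝ) *
            ((I (j.1 * h)).2 - (I (j.1 * h)).1) - ((I (j.1 * h)).1 + ((1:unitInterval):ℝ) *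
            ((I (j.1 * h)).2 - (I (j.1 * h)).1)))
          simp only [Set.Icc.coe_zero, Set.Icc.coe_one] at h3 h5
          linarith) hm
      simpa using this
    have hsum := Finset.card_filter_add_card_filter_not (s := F N)
      (fun f => (I (f * h)).2 - (I (f * h)).1 < η)
    set b := ((F N).filter (fun f => (I (f * h)).2 - (I (f * h)).1 < η)).card with hb
    have hb' : 2 ^ n * b ≤ (F N).card := by exact_mod_cast hh
    have hb2 : (2:ENNReal) ^ n * b ≤ (F N).card := by exact_mod_cast hb'
    have hb3 : (b : ENNReal) ≤ 2⁻¹ ^ n * (F N).card := by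
      calc (b : ENNReal) = 2⁻¹ ^ n * ((2:ENNReal) ^ n * b) := by
            rw [← mul_assoc, ← mul_pow, ENNReal.inv_mul_cancel (by simp) (by simp), one_pow, one_mul]
        _ ≤ _ := by gcongr
    have h1 : ((F N).card : ENNReal) ≤ m + 2⁻¹ ^ n * (F N).card := by
      have : ((F N).card : ENNReal) = b + J.card := by rw [← hsum]; push_cast; rfl
      have h2 : (J.card : ENNReal) ≤ m := by exact_mod_cast hcard
      calc ((F N).card : ENNReal) = b + J.card := this
        _ ≤ 2⁻¹ ^ n * (F N).card + m := add_le_add hb3 h2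
        _ = _ := add_comm _ _
    rw [ENNReal.sub_mul (fun _ _ => ENNReal.natCast_ne_top _), one_mul]
    exact tsub_le_iff_right.2 h1
  have hlim : Tendsto (fun n : ℕ => 1 - (2⁻¹ : ENNReal) ^ n) atTop (𝓝 (1 - 0)) :=
    ENNReal.Tendsto.sub tendsto_const_nhds
      (ENNReal.tendsto_pow_atTop_nhds_zero_of_lt_one (by simp)) (Or.inl (by simp))
  rw [tsub_zero] at hlim
  exact le_of_tendsto' hlim key

lemma mdim_upper {G : Type} [Group G] (X : Set (G → unitInterval))
    {ρ : (G → unitInterval) → (G → unitInterval) → ℝ} (hρ : IsCompatMetric ρ)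
    (F : ℕ → Finset G) (hF : IsFolner F) : mdimWith X ρ F hF.1 ≤ 1 := by
  classical
  refine iSup₂_le fun ε hε => ?_
  obtain ⟨K, hK⟩ := compat_window hρ hε
  refine ENNReal.le_of_forall_pos_le_add fun δ hδ _ => ?_
  refine Filter.limsup_le_of_le (by isBoundedDefault) ?_
  filter_upwards [folner_mul_card hF K (show (0:ℝ) < δ by exact_mod_cast hδ)] with N hN
  refine ENNReal.div_le_of_le_mul ?_
  set L := Finset.image₂ (fun k g => k * g) K (F N) with hL
  have h1 : dimEps X (fun x y => (F N).sup' (hF.1 N) fun g => ρ (shift g x.1) (shift g y.1)) ε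
      ≤ (L.card : ENNReal) := by
    refine le_trans (sInf_le ⟨L → unitInterval, inferInstance, fun x a => x.1 a.1, inferInstance,
      continuous_pi fun a => (continuous_apply a.1).comp continuous_subtype_val, ?_, rfl⟩) ((topDim_cube L).trans (by simp))
    intro x y hxy
    refine Finset.sup'_le _ _ fun g hg => hK _ _ fun k hk => ?_
    exact congrFun hxy ⟨k * g, Finset.mem_image₂_of_mem hk hg⟩
  refine h1.trans ?_
  have h2 : (L.card : NNReal) ≤ (1 + δ) * (F N).card := by
    rw [← NNReal.coe_le_coe]; push_cast; exact hN
  exact_mod_cast h2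

theorem stmt15 {G : Type} [Group G] [Countable G] [Infinite G]
    (hAmen : ∃ F : ℕ → Finset G, IsFolner F) :
    ∃ X : Set (G → unitInterval), X.Nonempty ∧ IsClosed X ∧
      (∀ (g : G), ∀ x ∈ X, shift g x ∈ X) ∧
      (∀ x ∈ X, closure (Set.range fun g : G => shift g x) = X) ∧
      ∀ (ρ : (G → unitInterval) → (G → unitInterval) → ℝ), IsCompatMetric ρ →
        ∀ (F : ℕ → Finset G) (hF : IsFolner F),
          mdimWith X ρ F hF.1 = 1 := by
  obtain ⟨I, hI, hw, hR⟩ := exists_intervals hAmen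
  refine ⟨boxShift I, ?_, isClosed_closure, boxShift_shift I, fun x hx => box_minimal hI hR hx,
    fun ρ hρ F hF => le_antisymm (mdim_upper _ hρ F hF) (mdim_lower hI hw hρ F hF)⟩
  exact ⟨_, mem_boxShift I 1 (fun g => ⟨(I g).1, (hI g).1, (hI g).2.1.le.trans (hI g).2.2⟩)
    (fun g => ⟨le_rfl, (hI g).2.1.le⟩)⟩
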